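/- Assume the Reissner–Nordström radial setup and the notion of Dirichlet eigenvalue stated in the context. Let p ≥ 2 be an integer, C₁ > 0, S₀ > 0 sufficiently large, and δ ∈ (0, 1). There exist constants C > 0 and D > 0, depending only on δ, S₀, p, C₁, M, 𝐞, m, such that for all sufficiently large integers L the following holds. Suppose ω ∈ (0, m) satisfies L^{−p} ≤ m² − ω² ≤ C₁·L^{−2}; set 𝓔 = inf { |m² − ω² + λ| : λ ≤ 0 is a Dirichlet eigenvalue at level (L, S₀) } and assume 0 < 𝓔 ≤ e^{−(1/2)·𝕃·log 𝕃}. If u is a weakly outgoing C² solution of u'' − V(ω, L, ·)·u = H and H vanishes identically on {s > S₀}, then ∫_{−∞}^{∞} [ (r/(r − r₊))·|u' + iωu|² + (1 + max(0, −s)^{1+δ})⁻¹·(|u'|² + |u|²) ] ds ≤ C·𝓔⁻²·e^{D·L}·∫_{−∞}^{S₀} (r/(r − r₊))·|H|² ds. -/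

import Mathlib

open MeasureTheory Filter Set

/-- The radial Klein–Gordon potential on a subextremal Reissner–Nordström exterior,
expressed in the tortoise-type coordinate `s` via the inverse map `rofs = r(s)`. -/
noncomputable def Vpot (M m E : ℝ) (rofs : ℝ → ℝ) (ω : ℝ) (L : ℕ) (s : ℝ) : ℝ :=
  -ω ^ 2 + (1 - 2 * M / rofs s + E ^ 2 / rofs s ^ 2) *
    (m ^ 2 + ((L : ℝ) * ((L : ℝ) + 1)) / rofs s ^ 2 +
      (2 * M * rofs s - 2 * E ^ 2) / rofs s ^ 4)

/-- `u` is weakly outgoing: `u ∼ c·e^{−iωs}` (with its derivative) as `s → −∞`, and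
`u` together with `u'` decays exponentially as `s → +∞`. -/
def WeaklyOutgoing (ω : ℝ) (u : ℝ → ℂ) : Prop :=
  (∃ c : ℂ,
    Filter.Tendsto (fun s : ℝ => u s - c * Complex.exp (-Complex.I * (ω : ℂ) * (s : ℂ)))
      Filter.atBot (nhds 0) ∧
    Filter.Tendsto (fun s : ℝ =>
        deriv u s + Complex.I * (ω : ℂ) * c * Complex.exp (-Complex.I * (ω : ℂ) * (s : ℂ)))
      Filter.atBot (nhds 0)) ∧
  ∃ ε : ℝ, 0 < ε ∧
    Filter.Tendsto (fun s : ℝ => Real.exp (ε * s) * (‖u s‖ + ‖deriv u s‖))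
      Filter.atTop (nhds 0)

/-- The omega-independent reference potential W0(s) = V(w,L,s) + w^2 - m^2. -/
noncomputable def W0 (M m E : ℝ) (rofs : ℝ → ℝ) (L : ℕ) (s : ℝ) : ℝ :=
  (1 - 2 * M / rofs s + E ^ 2 / rofs s ^ 2) *
    (m ^ 2 + ((L : ℝ) * ((L : ℝ) + 1)) / rofs s ^ 2 +
      (2 * M * rofs s - 2 * E ^ 2) / rofs s ^ 4) - m ^ 2

/-- lam is a Dirichlet eigenvalue at level (L, S0) of -d^2/ds^2 + W0 on (S0, inf). -/
def IsDirichletEV (M m E : ℝ) (rofs : ℝ → ℝ) (L : ℕ) (S₀ lam : ℝ) : Prop :=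
  ∃ ψ : ℝ → ℝ,
    (∃ x ∈ Set.Ioi S₀, ψ x ≠ 0) ∧
    ContDiffOn ℝ 2 ψ (Set.Ioi S₀) ∧
    (∫⁻ x in Set.Ioi S₀, ENNReal.ofReal (ψ x ^ 2)) < ⊤ ∧
    (∫⁻ x in Set.Ioi S₀, ENNReal.ofReal (deriv ψ x ^ 2)) < ⊤ ∧
    (∫⁻ x in Set.Ioi S₀, ENNReal.ofReal (deriv (deriv ψ) x ^ 2)) < ⊤ ∧
    Filter.Tendsto ψ (nhdsWithin S₀ (Set.Ioi S₀)) (nhds 0) ∧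
    ∀ x ∈ Set.Ioi S₀, -deriv (deriv ψ) x + W0 M m E rofs L x * ψ x = lam * ψ x

theorem norm_integral_exp_smul_le {E : Type*} [NormedAddCommGroup E] [NormedSpace ℝ E]
    {g : ℝ → E} {a s c K : ℝ} (hc : 0 < c) (hs : a ≤ s) (hg : ∀ t, ‖g t‖ ≤ K) :
    ‖∫ t in a..s, Real.exp (c * (t - a)) • g t‖ ≤ K / c * Real.exp (c * (s - a)) := by
  have hK : 0 ≤ K := (norm_nonneg _).trans (hg a)
  have hderiv : ∀ t ∈ Set.uIcc a s,
      HasDerivAt (fun t => K / c * Real.exp (c * (t - a))) (K * Real.exp (c * (t - a))) t := by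
    intro t _
    have h := (((hasDerivAt_id t).sub_const a).const_mul c).exp.const_mul (K / c)
    refine h.congr_deriv ?_
    simp only [id]
    field_simp
  have hcont : Continuous fun t : ℝ => K * Real.exp (c * (t - a)) := by fun_prop
  have hInt := intervalIntegral.integral_eq_sub_of_hasDerivAt hderiv
    (hcont.intervalIntegrable a s)
  calc ‖∫ t in a..s, Real.exp (c * (t - a)) • g t‖
      ≤ ∫ t in a..s, K * Real.exp (c * (t - a)) := by
        refine intervalIntegral.norm_integral_le_of_norm_le hs ?_ (hcont.intervalIntegrable a s)
        refine Eventually.of_forall fun t _ => ?_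
        rw [norm_smul, Real.norm_eq_abs, Real.abs_exp, mul_comm]
        exact mul_le_mul_of_nonneg_right (hg t) (Real.exp_pos _).le
    _ ≤ K / c * Real.exp (c * (s - a)) := by
        rw [hInt]
        have : 0 ≤ K / c * Real.exp (c * (a - a)) := by positivity
        linarith

/-- Global forward solvability of a linear differential equation with bounded coefficients. -/
theorem exists_solution_of_linear_ode {E : Type*} [NormedAddCommGroup E] [NormedSpace ℝ E]
    [CompleteSpace E] {A : ℝ → E →L[ℝ] E} (hA : Continuous A) {B : ℝ} (hB : ∀ t, ‖A t‖ ≤ B)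
    (a : ℝ) (x₀ : E) :
    ∃ Y : ℝ → E, Y a = x₀ ∧ Continuous Y ∧ ∀ t, a ≤ t → HasDerivAt Y (A t (Y t)) t := by
  have hB0 : 0 ≤ B := (norm_nonneg _).trans (hB a)
  set c : ℝ := 2 * (B + 1) with hc
  have hcpos : 0 < c := by positivity
  have hBc : B / c ≤ 1 / 2 := by
    rw [div_le_div_iff₀ hcpos two_pos, hc]; linarith
  have hInt : ∀ w : BoundedContinuousFunction ℝ E,
      Continuous fun t => Real.exp (c * (t - a)) • A t (w t) := fun w => by
    have : Continuous fun t => A t (w t) := hA.clm_apply w.continuous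
    fun_prop
  have hAw : ∀ (w : BoundedContinuousFunction ℝ E) t, ‖A t (w t)‖ ≤ B * ‖w‖ := fun w t =>
    (A t).le_of_opNorm_le_of_le (hB t) (w.norm_coe_le_norm t)
  let I : BoundedContinuousFunction ℝ E → ℝ → E := fun w s =>
    x₀ + ∫ t in a..s, Real.exp (c * (t - a)) • A t (w t)
  have hIc : ∀ w, Continuous (I w) := fun w =>
    continuous_const.add (intervalIntegral.continuous_primitive
      (fun _ _ => (hInt w).intervalIntegrable _ _) a)
  have hTbound : ∀ w s, ‖Real.exp (-(c * (max s a - a))) • I w (max s a)‖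
      ≤ ‖x₀‖ + B * ‖w‖ / c := by
    intro w s
    have hs : a ≤ max s a := le_max_right _ _
    have h1 := norm_integral_exp_smul_le hcpos hs (hAw w)
    rw [norm_smul, Real.norm_eq_abs, Real.abs_exp]
    have h2 : ‖I w (max s a)‖ ≤ ‖x₀‖ + B * ‖w‖ / c * Real.exp (c * (max s a - a)) :=
      (norm_add_le _ _).trans (by linarith)
    have h3 : Real.exp (-(c * (max s a - a))) ≤ 1 :=
      Real.exp_le_one_iff.mpr (by nlinarith [mul_nonneg hcpos.le (sub_nonneg.mpr hs)])
    have h4 : Real.exp (-(c * (max s a - a))) * Real.exp (c * (max s a - a)) = 1 := by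
      rw [← Real.exp_add]; simp
    calc _ ≤ Real.exp (-(c * (max s a - a))) *
          (‖x₀‖ + B * ‖w‖ / c * Real.exp (c * (max s a - a))) := by gcongr
      _ = Real.exp (-(c * (max s a - a))) * ‖x₀‖ + B * ‖w‖ / c *
          (Real.exp (-(c * (max s a - a))) * Real.exp (c * (max s a - a))) := by ring
      _ ≤ _ := by rw [h4]; nlinarith [norm_nonneg x₀]
  let T : BoundedContinuousFunction ℝ E → BoundedContinuousFunction ℝ E := fun w =>
    BoundedContinuousFunction.ofNormedAddCommGroup
      (fun s => Real.exp (-(c * (max s a - a))) • I w (max s a))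
      (by have := (hIc w).comp (continuous_id.max (continuous_const (y := a)))
          exact Continuous.smul (by fun_prop) this) _ (hTbound w)
  have hT : ContractingWith (1 / 2) T := by
    refine ⟨by norm_num [← NNReal.coe_lt_coe], LipschitzWith.of_dist_le_mul fun w₁ w₂ => ?_⟩
    rw [BoundedContinuousFunction.dist_le (by positivity)]
    intro s
    have hs : a ≤ max s a := le_max_right _ _
    have h1 := norm_integral_exp_smul_le hcpos hs (hAw (w₁ - w₂))
    have h4 : Real.exp (-(c * (max s a - a))) * Real.exp (c * (max s a - a)) = 1 := by
      rw [← Real.exp_add]; simp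
    have h5 : I w₁ (max s a) - I w₂ (max s a) =
        ∫ t in a..(max s a), Real.exp (c * (t - a)) • A t ((w₁ - w₂) t) := by
      simp only [I, add_sub_add_left_eq_sub]
      rw [← intervalIntegral.integral_sub ((hInt w₁).intervalIntegrable _ _)
        ((hInt w₂).intervalIntegrable _ _)]
      simp [smul_sub]
    change dist (Real.exp (-(c * (max s a - a))) • I w₁ (max s a))
      (Real.exp (-(c * (max s a - a))) • I w₂ (max s a)) ≤ _
    rw [dist_eq_norm, ← smul_sub, h5, norm_smul, Real.norm_eq_abs, Real.abs_exp, dist_eq_norm]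
    calc _ ≤ Real.exp (-(c * (max s a - a))) *
          (B * ‖w₁ - w₂‖ / c * Real.exp (c * (max s a - a))) := by gcongr
      _ = B / c * ‖w₁ - w₂‖ *
          (Real.exp (-(c * (max s a - a))) * Real.exp (c * (max s a - a))) := by ring
      _ ≤ _ := by
        rw [h4, mul_one]
        have : ((1 / 2 : NNReal) : ℝ) = 1 / 2 := by norm_num
        rw [this]
        gcongr
  set w := ContractingWith.fixedPoint T hT with hw
  have hfix : T w = w := hT.fixedPoint_isFixedPt
  have hwI : ∀ s, a ≤ s → Real.exp (c * (s - a)) • w s = I w s := by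
    intro s hs
    have : w s = Real.exp (-(c * (max s a - a))) • I w (max s a) := by
      conv_lhs => rw [← hfix]
      rfl
    rw [this, max_eq_left hs, smul_smul, ← Real.exp_add]
    simp
  refine ⟨I w, by simp [I], hIc w, fun t ht => ?_⟩
  have h := (intervalIntegral.integral_hasDerivAt_right ((hInt w).intervalIntegrable a t)
    (hInt w).aestronglyMeasurable.stronglyMeasurableAtFilter
    (hInt w).continuousAt).const_add x₀
  refine h.congr_deriv ?_
  rw [← hwI t ht, map_smul]
/-- `y` solves `y'' = q y` at the point `s`, with derivative `z`. -/
def SolvesAt (q y z : ℝ → ℝ) (s : ℝ) : Prop :=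
  HasDerivAt y (z s) s ∧ HasDerivAt z (q s * y s) s

/-- Solutions of `y'' = (q - τ) y` with fixed initial data depend continuously on `τ`. -/
theorem exists_solution_family {q : ℝ → ℝ} (hq : Continuous q) {B : ℝ} (hB : ∀ s, |q s| ≤ B)
    {e : ℝ} (he : 0 ≤ e) (a y₀ z₀ : ℝ) :
    ∃ y z : ℝ → ℝ → ℝ, Continuous (fun p : ℝ × ℝ => y p.1 p.2) ∧
      Continuous (fun p : ℝ × ℝ => z p.1 p.2) ∧
      ∀ τ ∈ Icc (-e) e, y τ a = y₀ ∧ z τ a = z₀ ∧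
        ∀ s, a ≤ s → SolvesAt (fun x => q x - τ) (y τ) (z τ) s := by
  have hee : -e ≤ e := by linarith
  let ι : C(Icc (-e) e, ℝ) := ⟨fun τ => (τ : ℝ), continuous_subtype_val⟩
  let P : C(Icc (-e) e, ℝ) × C(Icc (-e) e, ℝ) →L[ℝ] C(Icc (-e) e, ℝ) :=
    ContinuousLinearMap.fst ℝ C(Icc (-e) e, ℝ) C(Icc (-e) e, ℝ)
  let A₁ : C(Icc (-e) e, ℝ) × C(Icc (-e) e, ℝ) →L[ℝ] C(Icc (-e) e, ℝ) × C(Icc (-e) e, ℝ) :=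
    (0 : C(Icc (-e) e, ℝ) × C(Icc (-e) e, ℝ) →L[ℝ] C(Icc (-e) e, ℝ)).prod P
  let A₀ : C(Icc (-e) e, ℝ) × C(Icc (-e) e, ℝ) →L[ℝ] C(Icc (-e) e, ℝ) × C(Icc (-e) e, ℝ) :=
    (ContinuousLinearMap.snd ℝ C(Icc (-e) e, ℝ) C(Icc (-e) e, ℝ)).prod
    (-((ContinuousLinearMap.mul ℝ C(Icc (-e) e, ℝ) ι).comp P))
  obtain ⟨Y, hY0, hYc, hYd⟩ := exists_solution_of_linear_ode
    (A := fun t => A₀ + q t • A₁) (by fun_prop) (B := ‖A₀‖ + B * ‖A₁‖)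
    (fun t => (norm_add_le _ _).trans (by
      rw [norm_smul, Real.norm_eq_abs]
      gcongr
      exact hB t)) a
    ((ContinuousMap.const _ y₀, ContinuousMap.const _ z₀) : C(Icc (-e) e, ℝ) × C(Icc (-e) e, ℝ))
  refine ⟨fun τ s => (Y s).1 (projIcc (-e) e hee τ), fun τ s => (Y s).2 (projIcc (-e) e hee τ),
    ?_, ?_, fun τ hτ => ⟨?_, ?_, fun s hs => ?_⟩⟩
  · exact (continuous_eval (F := C(Icc (-e) e, ℝ))).comp
      ((continuous_fst.comp (hYc.comp continuous_snd)).prodMk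
      ((continuous_projIcc (h := hee)).comp continuous_fst))
  · exact (continuous_eval (F := C(Icc (-e) e, ℝ))).comp
      ((continuous_snd.comp (hYc.comp continuous_snd)).prodMk
      ((continuous_projIcc (h := hee)).comp continuous_fst))
  · simp [hY0]
  · simp [hY0]
  · have hτ' : ((projIcc (-e) e hee τ : Icc (-e) e) : ℝ) = τ := by
      rw [projIcc_of_mem hee hτ]
    let ev : C(Icc (-e) e, ℝ) →L[ℝ] ℝ := ContinuousMap.evalCLM ℝ (projIcc (-e) e hee τ)
    have h1 := (ev.comp (ContinuousLinearMap.fst ℝ C(Icc (-e) e, ℝ) C(Icc (-e) e, ℝ))).hasFDerivAt.comp_hasDerivAt s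
      (hYd s hs)
    have h2 := (ev.comp (ContinuousLinearMap.snd ℝ C(Icc (-e) e, ℝ) C(Icc (-e) e, ℝ))).hasFDerivAt.comp_hasDerivAt s
      (hYd s hs)
    constructor
    · refine h1.congr_deriv ?_
      simp [ev, A₀, A₁]
    · refine h2.congr_deriv ?_
      simp [ev, A₀, A₁, P, ι, hτ']
      ring
theorem sq_deriv_le_integral_sq {q y z : ℝ → ℝ} {a B : ℝ} (hq : Continuous q)
    (h : ∀ s ∈ Icc a (a + 1), SolvesAt q y z s) (hB : ∀ s ∈ Icc a (a + 1), |q s| ≤ B) :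
    z a ^ 2 ≤ (B + 6) ^ 2 * ∫ s in a..(a + 1), y s ^ 2 := by
  have hu : uIcc a (a + 1) = Icc a (a + 1) := uIcc_of_le (by linarith)
  have hyc : ContinuousOn y (uIcc a (a + 1)) := fun s hs =>
    (h s (hu ▸ hs)).1.continuousAt.continuousWithinAt
  set g : ℝ → ℝ := fun s =>
    ((1 - 3 * (s - a) ^ 2 + 2 * (s - a) ^ 3) * q s - (-6 + 12 * (s - a))) * y s with hg
  have hgc : ContinuousOn g (uIcc a (a + 1)) := by
    have : Continuous fun s : ℝ =>
      ((1 - 3 * (s - a) ^ 2 + 2 * (s - a) ^ 3) * q s - (-6 + 12 * (s - a))) := by fun_prop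
    exact this.continuousOn.mul hyc
  have hInt : ∫ s in a..(a + 1), g s = -z a := by
    have hd : ∀ s ∈ uIcc a (a + 1), HasDerivAt (fun s =>
        (1 - 3 * (s - a) ^ 2 + 2 * (s - a) ^ 3) * z s - (-6 * (s - a) + 6 * (s - a) ^ 2) * y s)
        (g s) s := by
      intro s hs
      obtain ⟨h1, h2⟩ := h s (hu ▸ hs)
      have hx := (hasDerivAt_id s).sub_const a
      have := ((((hx.pow 2).const_mul 3).const_sub 1).add ((hx.pow 3).const_mul 2)).mul h2 |>.sub
        (((hx.const_mul (-6)).add ((hx.pow 2).const_mul 6)).mul h1)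
      refine this.congr_deriv ?_
      simp [hg]
      ring
    rw [intervalIntegral.integral_eq_sub_of_hasDerivAt hd hgc.intervalIntegrable]
    ring
  have hsq : ∫ s in a..(a + 1), (g s - -z a) ^ 2 = (∫ s in a..(a + 1), g s ^ 2) - z a ^ 2 := by
    have : ∀ s, (g s - -z a) ^ 2 = (g s ^ 2 + 2 * z a * g s) + z a ^ 2 := fun s => by ring
    simp_rw [this]
    rw [intervalIntegral.integral_add, intervalIntegral.integral_add,
      intervalIntegral.integral_const_mul, hInt]
    · simp
      ring
    · exact (hgc.pow 2).intervalIntegrable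
    · exact (continuousOn_const.mul hgc).intervalIntegrable
    · exact ((hgc.pow 2).add (continuousOn_const.mul hgc)).intervalIntegrable
    · exact continuousOn_const.intervalIntegrable
  have hnn : 0 ≤ ∫ s in a..(a + 1), (g s - -z a) ^ 2 :=
    intervalIntegral.integral_nonneg (by linarith) fun s _ => sq_nonneg _
  have hle : ∫ s in a..(a + 1), g s ^ 2 ≤ ∫ s in a..(a + 1), (B + 6) ^ 2 * y s ^ 2 := by
    refine intervalIntegral.integral_mono_on (by linarith) (hgc.pow 2).intervalIntegrable
      (continuousOn_const.mul (hyc.pow 2)).intervalIntegrable fun s hs => ?_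
    have hx0 : 0 ≤ s - a := by linarith [hs.1]
    have hx1 : s - a ≤ 1 := by linarith [hs.2]
    set x := s - a
    have h1 : |1 - 3 * x ^ 2 + 2 * x ^ 3| ≤ 1 := by
      rw [abs_le]
      constructor <;> nlinarith [mul_nonneg hx0 hx0, mul_nonneg (mul_nonneg hx0 hx0) hx0,
        mul_nonneg (mul_nonneg hx0 hx0) (sub_nonneg.mpr hx1)]
    have h2 : |-6 + 12 * x| ≤ 6 := by rw [abs_le]; constructor <;> linarith
    have h3 : |(1 - 3 * x ^ 2 + 2 * x ^ 3) * q s - (-6 + 12 * x)| ≤ B + 6 := by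
      refine (abs_sub _ _).trans (add_le_add ?_ h2)
      rw [abs_mul]
      calc _ ≤ 1 * B := mul_le_mul h1 (hB s hs) (abs_nonneg _) zero_le_one
        _ = B := one_mul _
    rw [hg, mul_pow]
    refine mul_le_mul_of_nonneg_right ?_ (sq_nonneg _)
    exact sq_le_sq' (abs_le.mp h3).1 (abs_le.mp h3).2
  rw [intervalIntegral.integral_const_mul] at hle
  linarith

/-- A function with `g' ≥ (g / b)²` that starts at height `k` cannot exist for longer than
`b² / k`. -/
theorem blowup_bound {g g' : ℝ → ℝ} {b k t₁ t₂ : ℝ} (hb : 0 < b) (hk : 0 < k) (ht : t₁ ≤ t₂)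
    (hg : ContinuousOn g (Icc t₁ t₂)) (hd : ∀ t ∈ Ioo t₁ t₂, HasDerivAt g (g' t) t)
    (hle : ∀ t ∈ Ioo t₁ t₂, g t ^ 2 ≤ b ^ 2 * g' t) (h₁ : k ≤ g t₁) :
    k * (t₂ - t₁) ≤ b ^ 2 := by
  have hmono : MonotoneOn g (Icc t₁ t₂) := by
    refine monotoneOn_of_deriv_nonneg (convex_Icc _ _) hg ?_ ?_
    · rw [interior_Icc]
      exact fun t h => (hd t h).differentiableAt.differentiableWithinAt
    · rw [interior_Icc]
      intro t h
      rw [(hd t h).deriv]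
      have := (sq_nonneg _).trans (hle t h)
      exact nonneg_of_mul_nonneg_right this (by positivity)
  have hpos : ∀ t ∈ Icc t₁ t₂, 0 < g t := fun t h =>
    hk.trans_le (h₁.trans (hmono (left_mem_Icc.mpr ht) h h.1))
  have hmono2 : MonotoneOn (fun t => -(g t)⁻¹ - t / b ^ 2) (Icc t₁ t₂) := by
    have hder : ∀ t ∈ Ioo t₁ t₂, HasDerivAt (fun t => -(g t)⁻¹ - t / b ^ 2)
        (g' t / g t ^ 2 - 1 / b ^ 2) t := fun t h => by
      have := ((hd t h).inv (hpos t (Ioo_subset_Icc_self h)).ne').neg.sub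
        ((hasDerivAt_id t).div_const (b ^ 2))
      refine this.congr_deriv ?_
      ring
    refine monotoneOn_of_deriv_nonneg (convex_Icc _ _) ?_ ?_ ?_
    · exact (hg.inv₀ fun t h => (hpos t h).ne').neg.sub (by fun_prop)
    · rw [interior_Icc]
      exact fun t h => (hder t h).differentiableAt.differentiableWithinAt
    · rw [interior_Icc]
      intro t h
      have h0 := hpos t (Ioo_subset_Icc_self h)
      rw [(hder t h).deriv, sub_nonneg, div_le_div_iff₀ (by positivity) (by positivity)]
      linarith [hle t h]
  have h := hmono2 (left_mem_Icc.mpr ht) (right_mem_Icc.mpr ht) ht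
  simp only at h
  have h2 : 0 < (g t₂)⁻¹ := inv_pos.mpr (hpos _ (right_mem_Icc.mpr ht))
  have h3 : (g t₁)⁻¹ ≤ k⁻¹ := inv_anti₀ hk h₁
  have h4 : (t₂ - t₁) / b ^ 2 ≤ k⁻¹ := by rw [sub_div]; linarith
  rw [div_le_iff₀ (by positivity), inv_mul_eq_div, le_div_iff₀ hk] at h4
  linarith

theorem integral_sq_le_of_ne_zero {q : ℝ → ℝ} {y z : ℝ → ℝ → ℝ} {a R e B f₀ f₁ : ℝ}
    (hq : Continuous q) (hy : Continuous fun p : ℝ × ℝ => y p.1 p.2)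
    (hsol : ∀ τ ∈ Icc (-e) e, ∀ s, a ≤ s → SolvesAt (fun x => q x - τ) (y τ) (z τ) s)
    (hR : a + 1 ≤ R) (hy₀ : ∀ τ ∈ Icc (-e) e, y τ R = f₀) (hz₀ : ∀ τ ∈ Icc (-e) e, z τ R = f₁)
    (hB : ∀ s ∈ Icc a (a + 1), |q s| ≤ B) (he0 : 0 < e) (he1 : e ≤ 1)
    (hne : ∀ τ ∈ Icc (-e) e, y τ a ≠ 0) :
    ∫ s in a..R, y 0 s ^ 2 ≤ (2 * (B + 7) / e) ^ 2 * y 0 a ^ 2 := by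
  have haR : a ≤ R := by linarith
  have hB0 : 0 ≤ B := (abs_nonneg _).trans (hB a (left_mem_Icc.mpr (by linarith)))
  have hy1 : ∀ τ, Continuous (y τ) := fun τ => hy.comp (by fun_prop : Continuous fun s => (τ, s))
  set m : ℝ → ℝ := fun τ => z τ a / y τ a with hm
  set n : ℝ → ℝ → ℝ := fun σ τ => (∫ s in a..R, y σ s * y τ s) / (y σ a * y τ a) with hn
  have hmn : ∀ σ ∈ Icc (-e) e, ∀ τ ∈ Icc (-e) e, m σ - m τ = (σ - τ) * n σ τ := by
    intro σ hσ τ hτ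
    have hd : ∀ s ∈ uIcc a R, HasDerivAt (fun s => y σ s * z τ s - z σ s * y τ s)
        ((σ - τ) * (y σ s * y τ s)) s := by
      intro s hs
      rw [uIcc_of_le haR] at hs
      obtain ⟨h1, h2⟩ := hsol σ hσ s hs.1
      obtain ⟨h3, h4⟩ := hsol τ hτ s hs.1
      refine ((h1.mul h4).sub (h2.mul h3)).congr_deriv ?_
      ring
    have hI := intervalIntegral.integral_eq_sub_of_hasDerivAt hd
      (((hy1 σ).mul (hy1 τ)).const_mul (σ - τ) |>.intervalIntegrable a R)
    rw [intervalIntegral.integral_const_mul, hy₀ σ hσ, hz₀ σ hσ, hy₀ τ hτ, hz₀ τ hτ] at hI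
    have h1 := hne σ hσ
    have h2 := hne τ hτ
    rw [hm, hn]
    simp only
    rw [← mul_div_assoc, hI]
    field_simp
    ring
  have hnc : ContinuousOn (fun p : ℝ × ℝ => n p.1 p.2) (Icc (-e) e ×ˢ Icc (-e) e) := by
    refine ContinuousOn.div ?_ ?_ ?_
    · refine Continuous.continuousOn ?_
      refine intervalIntegral.continuous_parametric_intervalIntegral_of_continuous'
        (f := fun (p : ℝ × ℝ) s => y p.1 s * y p.2 s) ?_ a R
      exact (hy.comp (by fun_prop : Continuous fun x : (ℝ × ℝ) × ℝ => (x.1.1, x.2))).mul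
        (hy.comp (by fun_prop : Continuous fun x : (ℝ × ℝ) × ℝ => (x.1.2, x.2)))
    · exact ((hy.comp (by fun_prop : Continuous fun x : ℝ × ℝ => (x.1, a))).mul
        (hy.comp (by fun_prop : Continuous fun x : ℝ × ℝ => (x.2, a)))).continuousOn
    · exact fun p hp => mul_ne_zero (hne _ hp.1) (hne _ hp.2)
  have hmd : ∀ τ ∈ Ioo (-e) e, HasDerivAt m (n τ τ) τ := by
    intro τ hτ
    have hτ' := Ioo_subset_Icc_self hτ
    rw [hasDerivAt_iff_tendsto_slope]
    have h1 : Tendsto (fun σ => n σ τ) (nhds τ) (nhds (n τ τ)) := by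
      have h2 : ContinuousAt (fun p : ℝ × ℝ => n p.1 p.2) (τ, τ) :=
        hnc.continuousAt (prod_mem_nhds (Icc_mem_nhds hτ.1 hτ.2) (Icc_mem_nhds hτ.1 hτ.2))
      exact h2.tendsto.comp ((by fun_prop : Continuous fun σ : ℝ => (σ, τ)).tendsto τ)
    refine (h1.mono_left nhdsWithin_le_nhds).congr' ?_
    have h3 : ∀ᶠ σ in nhdsWithin τ {τ}ᶜ, σ ∈ Icc (-e) e :=
      nhdsWithin_le_nhds (Icc_mem_nhds hτ.1 hτ.2)
    filter_upwards [h3, self_mem_nhdsWithin] with σ hσ hne'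
    have : σ - τ ≠ 0 := sub_ne_zero.mpr hne'
    rw [slope_def_field, hmn σ hσ τ hτ']
    field_simp
  have hmc : ContinuousOn m (Icc (-e) e) := by
    intro τ hτ
    have h1 : ContinuousWithinAt (fun σ => m τ + (σ - τ) * n σ τ) (Icc (-e) e) τ := by
      refine continuousWithinAt_const.add (ContinuousWithinAt.mul (by fun_prop) ?_)
      exact ContinuousWithinAt.comp (f := fun σ : ℝ => (σ, τ)) (x := τ) (hnc (τ, τ) ⟨hτ, hτ⟩)
        (by fun_prop : ContinuousWithinAt (fun σ : ℝ => (σ, τ)) (Icc (-e) e) τ)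
        fun σ hσ => ⟨hσ, hτ⟩
    refine h1.congr (fun σ hσ => ?_) (by ring)
    rw [← hmn σ hσ τ hτ]; ring
  set K := n 0 0 with hK
  have h0e : (0 : ℝ) ∈ Icc (-e) e := ⟨by linarith, he0.le⟩
  have hnK : K ≤ n (e / 2) (-(e / 2)) := by
    have hcont : ContinuousOn (fun t => n t (-t)) (Icc 0 (e / 2)) :=
      hnc.comp (by fun_prop : ContinuousOn (fun t : ℝ => (t, -t)) (Icc 0 (e / 2)))
        fun t ht => ⟨⟨by linarith [ht.1], by linarith [ht.2]⟩,
          ⟨by linarith [ht.2], by linarith [ht.1]⟩⟩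
    have hder : ∀ t ∈ Ioo 0 (e / 2), HasDerivAt (fun t => n t (-t))
        ((n t t + n (-t) (-t) - 2 * n t (-t)) / (2 * t)) t := by
      intro t ht
      have ht1 : t ∈ Ioo (-e) e := ⟨by linarith [ht.1], by linarith [ht.2]⟩
      have ht2 : -t ∈ Ioo (-e) e := ⟨by linarith [ht.2], by linarith [ht.1]⟩
      have h0 : t ≠ 0 := ht.1.ne'
      have h1 : HasDerivAt (fun t => (m t - m (-t)) / (2 * t)) _ t :=
        (((hmd t ht1).sub ((hmd (-t) ht2).comp t (hasDerivAt_neg t))).div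
          ((hasDerivAt_id t).const_mul 2) (by simpa using h0))
      have h2 : (fun t => n t (-t)) =ᶠ[nhds t] fun t => (m t - m (-t)) / (2 * t) := by
        filter_upwards [Ioo_mem_nhds ht.1 ht.2] with r hr
        rw [hmn r ⟨by linarith [hr.1], by linarith [hr.2]⟩ (-r)
          ⟨by linarith [hr.2], by linarith [hr.1]⟩]
        have : r ≠ 0 := hr.1.ne'
        field_simp
        ring
      refine (h1.congr_of_eventuallyEq h2).congr_deriv ?_
      simp only [Function.comp, Pi.sub_apply]
      rw [hmn t (Ioo_subset_Icc_self ht1) (-t) (Ioo_subset_Icc_self ht2)]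
      field_simp
      ring
    have hmono : MonotoneOn (fun t => n t (-t)) (Icc 0 (e / 2)) := by
      refine monotoneOn_of_deriv_nonneg (convex_Icc _ _) hcont ?_ ?_
      · rw [interior_Icc]
        exact fun t h => (hder t h).differentiableAt.differentiableWithinAt
      · rw [interior_Icc]
        intro t ht
        rw [(hder t ht).deriv]
        refine div_nonneg ?_ (by linarith [ht.1])
        have hp : y t a ≠ 0 := hne t ⟨by linarith [ht.1], by linarith [ht.2]⟩
        have hp' : y (-t) a ≠ 0 := hne (-t) ⟨by linarith [ht.2], by linarith [ht.1]⟩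
        have key : n t t + n (-t) (-t) - 2 * n t (-t) =
            ∫ s in a..R, (y t s / y t a - y (-t) s / y (-t) a) ^ 2 := by
          have : ∀ s, (y t s / y t a - y (-t) s / y (-t) a) ^ 2 =
              y t s * y t s / (y t a * y t a) + y (-t) s * y (-t) s / (y (-t) a * y (-t) a)
              - 2 * (y t s * y (-t) s / (y t a * y (-t) a)) := fun s => by
            field_simp
            ring
          simp_rw [this]
          have c1 := hy1 t
          have c2 := hy1 (-t)
          rw [intervalIntegral.integral_sub, intervalIntegral.integral_add,
            intervalIntegral.integral_const_mul, intervalIntegral.integral_div,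
            intervalIntegral.integral_div, intervalIntegral.integral_div]
          all_goals
            refine Continuous.intervalIntegrable ?_ _ _
            fun_prop
        rw [key]
        exact intervalIntegral.integral_nonneg haR fun s _ => sq_nonneg _
    have := hmono (left_mem_Icc.mpr (by linarith)) (right_mem_Icc.mpr (by linarith))
      (by linarith : (0 : ℝ) ≤ e / 2)
    simpa using this
  have hmn2 : ∀ τ ∈ Icc (-e) e, m τ ^ 2 ≤ (B + 7) ^ 2 * n τ τ := by
    intro τ hτ
    have h1 := sq_deriv_le_integral_sq (B := B + 1) (hq.sub continuous_const)
      (fun s hs => hsol τ hτ s hs.1) (fun s hs => (abs_sub _ _).trans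
        (add_le_add (hB s hs) ((abs_le.mpr hτ).trans he1)))
    have h2 : ∫ s in a..(a + 1), y τ s ^ 2 ≤ ∫ s in a..R, y τ s ^ 2 :=
      intervalIntegral.integral_mono_interval le_rfl (by linarith) hR
        (Eventually.of_forall fun s => sq_nonneg _) (((hy1 τ).pow 2).intervalIntegrable _ _)
    have h3 : 0 < y τ a ^ 2 := by have := hne τ hτ; positivity
    simp only [hm, hn, div_pow, ← pow_two]
    rw [← mul_div_assoc]
    gcongr
    calc _ ≤ _ := h1
      _ ≤ (B + 7) ^ 2 * ∫ s in a..R, y τ s ^ 2 := by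
        rw [show B + 1 + 6 = B + 7 by ring]
        gcongr
  have hKbound : K ≤ (2 * (B + 7) / e) ^ 2 := by
    by_contra hcon
    push Not at hcon
    have hKpos : 0 < K := lt_of_le_of_lt (sq_nonneg _) hcon
    have hsum : e * K ≤ m (e / 2) - m (-(e / 2)) := by
      rw [hmn _ ⟨by linarith, by linarith⟩ _ ⟨by linarith, by linarith⟩]
      calc e * K ≤ e * n (e / 2) (-(e / 2)) := by gcongr
        _ = _ := by ring
    have hfin : K * (e / 2) * (e - e / 2) ≤ (B + 7) ^ 2 := by
      rcases le_total (e / 2 * K) (m (e / 2)) with h | h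
      · refine blowup_bound (g := m) (g' := fun t => n t t) (by linarith) (by positivity)
          (by linarith) (hmc.mono (Icc_subset_Icc (by linarith) le_rfl)) (fun t ht => ?_)
          (fun t ht => ?_) (by linarith)
        · exact hmd t ⟨by linarith [ht.1], ht.2⟩
        · exact hmn2 t ⟨by linarith [ht.1], ht.2.le⟩
      · refine blowup_bound (g := fun t => -m (-t)) (g' := fun t => n (-t) (-t)) (by linarith)
          (by positivity)
          (by linarith) ?_ (fun t ht => ?_) (fun t ht => ?_) (by linarith)
        · exact (hmc.comp (by fun_prop : ContinuousOn (fun t : ℝ => -t) (Icc (e / 2) e))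
            fun t ht => ⟨by linarith [ht.2], by linarith [ht.1]⟩).neg
        · have := ((hmd (-t) ⟨by linarith [ht.2], by linarith [ht.1]⟩).comp t
            (hasDerivAt_neg t)).neg
          exact this.congr_deriv (by ring)
        · rw [neg_sq]
          exact hmn2 (-t) ⟨by linarith [ht.2], by linarith [ht.1]⟩
    rw [div_pow, div_lt_iff₀ (by positivity)] at hcon
    nlinarith
  have h0 := hne 0 h0e
  have h00 : 0 < y 0 a * y 0 a := mul_self_pos.mpr h0
  rw [hK, hn] at hKbound
  simp only at hKbound
  rw [div_le_iff₀ h00] at hKbound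
  simpa [pow_two] using hKbound

theorem SolvesAt.continuousOn_left {q y z : ℝ → ℝ} {S : Set ℝ} (h : ∀ s ∈ S, SolvesAt q y z s) :
    ContinuousOn y S := fun s hs => (h s hs).1.continuousAt.continuousWithinAt

theorem SolvesAt.continuousOn_right {q y z : ℝ → ℝ} {S : Set ℝ} (h : ∀ s ∈ S, SolvesAt q y z s) :
    ContinuousOn z S := fun s hs => (h s hs).2.continuousAt.continuousWithinAt

theorem integral_energy_eq {Q y z : ℝ → ℝ} {a b : ℝ} (hab : a ≤ b) (hQ : Continuous Q)
    (h : ∀ s ∈ Icc a b, SolvesAt Q y z s) :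
    ∫ s in a..b, (z s ^ 2 + Q s * y s ^ 2) = y b * z b - y a * z a := by
  have hd : ∀ s ∈ uIcc a b, HasDerivAt (fun s => y s * z s) (z s ^ 2 + Q s * y s ^ 2) s := by
    intro s hs
    rw [uIcc_of_le hab] at hs
    refine ((h s hs).1.mul (h s hs).2).congr_deriv ?_
    ring
  refine intervalIntegral.integral_eq_sub_of_hasDerivAt hd (ContinuousOn.intervalIntegrable ?_)
  rw [uIcc_of_le hab]
  exact ((SolvesAt.continuousOn_right h).pow 2).add
    (hQ.continuousOn.mul ((SolvesAt.continuousOn_left h).pow 2))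

theorem wronskian_eq {Q y z u w : ℝ → ℝ} {a : ℝ} (h₁ : ∀ s, a ≤ s → SolvesAt Q y z s)
    (h₂ : ∀ s, a ≤ s → SolvesAt Q u w s) {s : ℝ} (hs : a ≤ s) :
    y s * w s - z s * u s = y a * w a - z a * u a := by
  have hd : ∀ x, a ≤ x → HasDerivAt (fun s => y s * w s - z s * u s) 0 x := fun x hx => by
    refine (((h₁ x hx).1.mul (h₂ x hx).2).sub ((h₁ x hx).2.mul (h₂ x hx).1)).congr_deriv ?_
    ring
  exact constant_of_has_deriv_right_zero
    (fun x hx => (hd x hx.1).continuousAt.continuousWithinAt)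
    (fun x hx => (hd x hx.1).hasDerivWithinAt) s (right_mem_Icc.mpr hs)

theorem monotoneOn_mul_of_solvesAt {Q y z : ℝ → ℝ} {a : ℝ} (h : ∀ s, a ≤ s → SolvesAt Q y z s)
    (hQ : ∀ s, a ≤ s → 0 ≤ Q s) : MonotoneOn (fun s => y s * z s) (Ici a) := by
  have hd : ∀ s, a ≤ s → HasDerivAt (fun s => y s * z s) (z s ^ 2 + Q s * y s ^ 2) s := by
    intro s hs
    refine ((h s hs).1.mul (h s hs).2).congr_deriv ?_
    ring
  refine monotoneOn_of_deriv_nonneg (convex_Ici a)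
    (fun s hs => (hd s hs).continuousAt.continuousWithinAt) ?_ ?_
  · rw [interior_Ici]
    exact fun s hs => (hd s (le_of_lt hs)).differentiableAt.differentiableWithinAt
  · rw [interior_Ici]
    intro s hs
    rw [(hd s (le_of_lt hs)).deriv]
    have := hQ s (le_of_lt hs)
    positivity

theorem exists_integral_sq_le_of_mul_nonpos {Q y z : ℝ → ℝ} {a R₁ k : ℝ} (hQ : Continuous Q)
    (hy : Continuous y) (hz : Continuous z) (h : ∀ s, a ≤ s → SolvesAt Q y z s) (hk : 0 < k)
    (haR : a ≤ R₁) (hR₁ : ∀ s, R₁ ≤ s → k ≤ Q s) (hneg : ∀ s, R₁ ≤ s → y s * z s ≤ 0) :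
    (∃ K, ∀ R, a ≤ R → ∫ s in a..R, y s ^ 2 ≤ K) ∧
      ∃ K, ∀ R, a ≤ R → ∫ s in a..R, z s ^ 2 ≤ K := by
  have hii : ∀ {g : ℝ → ℝ}, Continuous g → ∀ x y, IntervalIntegrable g volume x y :=
    fun hg x y => hg.intervalIntegrable x y
  have key : ∀ R, R₁ ≤ R → (∫ s in R₁..R, z s ^ 2) + k * ∫ s in R₁..R, y s ^ 2
      ≤ -(y R₁ * z R₁) := by
    intro R hR
    have h1 := integral_energy_eq hR hQ fun s hs => h s (haR.trans hs.1)
    have h2 : ∫ s in R₁..R, (z s ^ 2 + k * y s ^ 2) ≤ ∫ s in R₁..R, (z s ^ 2 + Q s * y s ^ 2) := by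
      refine intervalIntegral.integral_mono_on hR (hii (by fun_prop) _ _) (hii (by fun_prop) _ _)
        fun s hs => ?_
      have := hR₁ s hs.1
      gcongr
    rw [intervalIntegral.integral_add (hii (by fun_prop) _ _) (hii (by fun_prop) _ _),
      intervalIntegral.integral_const_mul] at h2
    linarith [hneg R hR]
  have ext : ∀ g : ℝ → ℝ, Continuous g → ∀ K, (∀ R, R₁ ≤ R → ∫ s in R₁..R, g s ^ 2 ≤ K) →
      ∀ R, a ≤ R → ∫ s in a..R, g s ^ 2 ≤ (∫ s in a..R₁, g s ^ 2) + K := by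
    intro g hg K hK R hR
    have h1 : ∫ s in a..R, g s ^ 2 ≤ ∫ s in a..(max R R₁), g s ^ 2 :=
      intervalIntegral.integral_mono_interval le_rfl hR (le_max_left _ _)
        (Eventually.of_forall fun s => sq_nonneg _) (hii (by fun_prop) _ _)
    rw [← intervalIntegral.integral_add_adjacent_intervals (b := R₁) (c := max R R₁)
      (hii (by fun_prop) _ _)
      (hii (by fun_prop) _ _)] at h1
    linarith [hK _ (le_max_right R R₁)]
  have nn : ∀ g : ℝ → ℝ, ∀ R, R₁ ≤ R → 0 ≤ ∫ s in R₁..R, g s ^ 2 := fun g R hR =>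
    intervalIntegral.integral_nonneg hR fun s _ => sq_nonneg _
  refine ⟨⟨_, ext y hy (-(y R₁ * z R₁) / k) fun R hR => ?_⟩,
    ⟨_, ext z hz (-(y R₁ * z R₁)) fun R hR => ?_⟩⟩
  · rw [le_div_iff₀ hk]
    linarith [key R hR, nn z R hR]
  · linarith [key R hR, mul_nonneg hk.le (nn y R hR)]

/-- A decaying solution of `f'' = q f` on a half-line is controlled by its boundary value, as
long as no nearby Dirichlet solution is square integrable. -/
theorem integral_sq_le_of_no_dirichlet {q f f' : ℝ → ℝ} {a B Bq e k R₁ : ℝ}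
    (hq : Continuous q) (hBq : ∀ s, |q s| ≤ Bq) (hB : ∀ s ∈ Icc a (a + 1), |q s| ≤ B)
    (he0 : 0 < e) (he1 : e ≤ 1) (hk : 0 < k) (haR : a ≤ R₁)
    (hR₁ : ∀ τ ∈ Icc (-e) e, ∀ s, R₁ ≤ s → k ≤ q s - τ)
    (hf : ∀ s, a ≤ s → SolvesAt q f f' s)
    (hlim : Tendsto (fun s => f s * f' s) atTop (nhds 0))
    (hno : ∀ τ ∈ Icc (-e) e, ∀ φ φ' : ℝ → ℝ, Continuous φ → Continuous φ' → φ a = 0 → φ' a = 1 →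
      (∀ s, a ≤ s → SolvesAt (fun x => q x - τ) φ φ' s) →
      (∃ K, ∀ R, a ≤ R → ∫ s in a..R, φ s ^ 2 ≤ K) →
      (∃ K, ∀ R, a ≤ R → ∫ s in a..R, φ' s ^ 2 ≤ K) → False)
    {R : ℝ} (hR : a ≤ R) :
    ∫ s in a..R, f s ^ 2 ≤ (2 * (B + 7) / e) ^ 2 * f a ^ 2 := by
  by_contra! hcon
  have h0e : (0 : ℝ) ∈ Icc (-e) e := ⟨by linarith, he0.le⟩
  obtain ⟨c, c', hc, hc', hcs⟩ := exists_solution_family hq hBq he0.le a 1 0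
  obtain ⟨φ, φ', hφ, hφ', hφs⟩ := exists_solution_family hq hBq he0.le a 0 1
  have hfl : ∀ s, a ≤ s → SolvesAt (fun x => q x - 0) f f' s := by simpa using hf
  have hW : ∀ τ ∈ Icc (-e) e, ∀ s, a ≤ s → c τ s * φ' τ s - c' τ s * φ τ s = 1 := by
    intro τ hτ s hs
    rw [wronskian_eq (hcs τ hτ).2.2 (hφs τ hτ).2.2 hs, (hcs τ hτ).1, (hcs τ hτ).2.1,
      (hφs τ hτ).1, (hφs τ hτ).2.1]
    ring
  have hWf : ∀ s, a ≤ s → f s * φ' 0 s - f' s * φ 0 s = f a := by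
    intro s hs
    rw [wronskian_eq hfl (hφs 0 h0e).2.2 hs, (hφs 0 h0e).1, (hφs 0 h0e).2.1]
    ring
  have hWc : ∀ s, a ≤ s → c 0 s * f' s - c' 0 s * f s = f' a := by
    intro s hs
    rw [wronskian_eq (hcs 0 h0e).2.2 hfl hs, (hcs 0 h0e).1, (hcs 0 h0e).2.1]
    ring
  have hrep : ∀ s, a ≤ s → f s = f a * c 0 s + f' a * φ 0 s := by
    intro s hs
    rw [← hWf s hs, ← hWc s hs]
    linear_combination (-f s) * hW 0 h0e s hs
  have hcomp : ∀ {g : ℝ → ℝ → ℝ}, Continuous (fun p : ℝ × ℝ => g p.1 p.2) → ∀ s,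
      Continuous fun τ => g τ s := fun hg s => hg.comp (by fun_prop : Continuous fun τ => (τ, s))
  have hcomp' : ∀ {g : ℝ → ℝ → ℝ}, Continuous (fun p : ℝ × ℝ => g p.1 p.2) → ∀ τ,
      Continuous (g τ) := fun hg τ => hg.comp (by fun_prop : Continuous fun s => (τ, s))
  have hmono : ∀ τ ∈ Icc (-e) e, MonotoneOn (fun s => φ τ s * φ' τ s) (Ici R₁) := fun τ hτ =>
    monotoneOn_mul_of_solvesAt (fun s hs => (hφs τ hτ).2.2 s (haR.trans hs))
      fun s hs => hk.le.trans (hR₁ τ hτ s hs)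
  have hff : ∀ s, R₁ ≤ s → f s * f' s ≤ 0 := by
    intro s hs
    have hm := monotoneOn_mul_of_solvesAt (fun s hs => hfl s (haR.trans hs))
      fun s hs => hk.le.trans (hR₁ 0 h0e s hs)
    refine ge_of_tendsto hlim ?_
    filter_upwards [eventually_ge_atTop s] with x hx
    exact hm hs (hs.trans hx) hx
  -- at every large radius some Dirichlet solution points in the direction of `f`
  have hex : ∀ T, R ≤ T → a + 1 ≤ T → R₁ ≤ T → ∃ τ ∈ Icc (-e) e, φ τ T * φ' τ T ≤ 0 := by
    intro T hRT haT hT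
    have haT' : a ≤ T := by linarith
    have hTcon : (2 * (B + 7) / e) ^ 2 * f a ^ 2 < ∫ s in a..T, f s ^ 2 := by
      refine hcon.trans_le ?_
      refine intervalIntegral.integral_mono_interval le_rfl hR hRT
        (Eventually.of_forall fun s => sq_nonneg _) (ContinuousOn.intervalIntegrable ?_)
      rw [uIcc_of_le haT']
      exact (SolvesAt.continuousOn_left fun s hs => hf s hs.1).pow 2
    by_contra! hpos
    set α : ℝ → ℝ := fun τ => f T * φ' τ T - f' T * φ τ T with hα
    set β : ℝ → ℝ := fun τ => c τ T * f' T - c' τ T * f T with hβ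
    have hαc : Continuous α := by
      have h1 := hcomp hφ T
      have h2 := hcomp hφ' T
      fun_prop
    have hβc : Continuous β := by
      have h1 := hcomp hc T
      have h2 := hcomp hc' T
      fun_prop
    have hα0 : α 0 = f a := hWf T haT'
    have hβ0 : β 0 = f' a := hWc T haT'
    have hf0 : ∀ s, a ≤ s → α 0 * c 0 s + β 0 * φ 0 s = f s := fun s hs => by
      rw [hα0, hβ0, ← hrep s hs]
    have hInt : ∫ s in a..T, (α 0 * c 0 s + β 0 * φ 0 s) ^ 2 = ∫ s in a..T, f s ^ 2 := by
      refine intervalIntegral.integral_congr fun s hs => ?_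
      rw [uIcc_of_le haT'] at hs
      rw [hf0 s hs.1]
    by_cases hne : ∀ τ ∈ Icc (-e) e, α τ * c τ a + β τ * φ τ a ≠ 0
    · have := integral_sq_le_of_ne_zero (y := fun τ s => α τ * c τ s + β τ * φ τ s)
        (z := fun τ s => α τ * c' τ s + β τ * φ' τ s) (f₀ := f T) (f₁ := f' T) hq
        (((hαc.comp continuous_fst).mul hc).add ((hβc.comp continuous_fst).mul hφ))
        (fun τ hτ s hs => ?_) haT (fun τ hτ => ?_) (fun τ hτ => ?_) hB he0 he1 hne
      · rw [hInt, hf0 a le_rfl] at this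
        linarith
      · obtain ⟨h1, h2⟩ := (hcs τ hτ).2.2 s hs
        obtain ⟨h3, h4⟩ := (hφs τ hτ).2.2 s hs
        refine ⟨(h1.const_mul _).add (h3.const_mul _), ?_⟩
        refine ((h2.const_mul _).add (h4.const_mul _)).congr_deriv ?_
        ring
      · simp only [hα, hβ]
        linear_combination f T * hW τ hτ T haT'
      · simp only [hα, hβ]
        linear_combination f' T * hW τ hτ T haT'
    · push Not at hne
      obtain ⟨τ, hτ, h0⟩ := hne
      rw [(hcs τ hτ).1, (hφs τ hτ).1] at h0
      have h1 : f T * φ' τ T = f' T * φ τ T := by simp only [hα] at h0; linarith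
      have h2 := hpos τ hτ
      have h3 := hff T hT
      by_cases hfT : f T = 0
      · have hfT' : f' T = 0 := by
          rw [hfT, zero_mul] at h1
          rcases mul_eq_zero.mp h1.symm with h | h
          · exact h
          · rw [h] at h2; simp at h2
        have : ∫ s in a..T, f s ^ 2 = 0 := by
          rw [← hInt]
          simp [hα, hβ, hfT, hfT']
        rw [this] at hTcon
        have : 0 ≤ (2 * (B + 7) / e) ^ 2 * f a ^ 2 := by positivity
        linarith
      · have h4 : (φ τ T * φ' τ T) * f T ^ 2 = φ τ T ^ 2 * (f T * f' T) := by
          linear_combination φ τ T * f T * h1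
        have h5 : 0 < (φ τ T * φ' τ T) * f T ^ 2 := by positivity
        nlinarith [sq_nonneg (φ τ T)]
  set T₀ := max R (max (a + 1) R₁) with hT₀
  have hT₀R : R ≤ T₀ := le_max_left _ _
  have hT₀a : a + 1 ≤ T₀ := (le_max_left _ _).trans (le_max_right _ _)
  have hT₀1 : R₁ ≤ T₀ := (le_max_right _ _).trans (le_max_right _ _)
  let S : ℕ → Set ℝ := fun n => Icc (-e) e ∩ {τ | φ τ (T₀ + n) * φ' τ (T₀ + n) ≤ 0}
  have hclosed : ∀ n : ℕ, IsClosed {τ | φ τ (T₀ + n) * φ' τ (T₀ + n) ≤ 0} := fun n =>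
    isClosed_le ((hcomp hφ _).mul (hcomp hφ' _)) continuous_const
  have hn0 : ∀ n : ℕ, (0 : ℝ) ≤ n := fun n => n.cast_nonneg
  obtain ⟨τ, hτ⟩ := IsCompact.nonempty_iInter_of_sequence_nonempty_isCompact_isClosed S
    (fun n τ hτ => ⟨hτ.1, by
      have h1 := hτ.2
      simp only [mem_ofPred_eq] at h1 ⊢
      refine le_trans (hmono τ hτ.1 ?_ ?_ ?_) h1
      · exact hT₀1.trans (by linarith [hn0 n])
      · exact hT₀1.trans (by linarith [hn0 (n + 1)])
      · push_cast; linarith⟩)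
    (fun n => by
      obtain ⟨τ, hτ, h⟩ := hex (T₀ + n) (by linarith [hn0 n]) (by linarith [hn0 n])
        (by linarith [hn0 n])
      exact ⟨τ, hτ, h⟩)
    (isCompact_Icc.inter_right (hclosed 0)) (fun n => isClosed_Icc.inter (hclosed n))
  rw [mem_iInter] at hτ
  have hτe := (hτ 0).1
  have hneg : ∀ s, R₁ ≤ s → φ τ s * φ' τ s ≤ 0 := by
    intro s hs
    obtain ⟨n, hn⟩ := exists_nat_ge (s - T₀)
    have h1 := (hτ n).2
    simp only [mem_ofPred_eq] at h1
    exact (hmono τ hτe hs (hT₀1.trans (by linarith [hn0 n]) : R₁ ≤ T₀ + n) (by linarith)).trans h1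
  obtain ⟨hK1, hK2⟩ := exists_integral_sq_le_of_mul_nonpos (hq.sub continuous_const)
    (hcomp' hφ τ) (hcomp' hφ' τ) (hφs τ hτe).2.2 hk haR (hR₁ τ hτe) hneg
  exact hno τ hτe (φ τ) (φ' τ) (hcomp' hφ τ) (hcomp' hφ' τ) (hφs τ hτe).1 (hφs τ hτe).2.1
    (hφs τ hτe).2.2 hK1 hK2

theorem log_mul_sub_mono {a b x y : ℝ} (hab : a < b) (hx : b < x) (hxy : x ≤ y) :
    Real.log ((x - a) * (x - b)) ≤ Real.log ((y - a) * (y - b)) := by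
  refine Real.log_le_log (mul_pos (by linarith) (by linarith)) ?_
  exact mul_le_mul (by linarith) (by linarith) (by linarith) (by linarith)

theorem radius_le_radius {rm rp κ : ℝ} {r : ℝ → ℝ} (hlt : rm < rp) (hκ : 0 < κ)
    (hr1 : ∀ s, rp < r s)
    (hr2 : ∀ s, r s + (2 * κ)⁻¹ * Real.log ((r s - rm) * (r s - rp)) = s) {s t : ℝ}
    (hst : s ≤ t) : r s ≤ r t := by
  by_contra! h
  have h1 := mul_le_mul_of_nonneg_left (log_mul_sub_mono hlt (hr1 t) h.le)
    (by positivity : 0 ≤ (2 * κ)⁻¹)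
  linarith [hr2 s, hr2 t]

theorem radius_sub_le {rm rp κ : ℝ} {r : ℝ → ℝ} (hlt : rm < rp) (hκ : 0 < κ)
    (hr1 : ∀ s, rp < r s)
    (hr2 : ∀ s, r s + (2 * κ)⁻¹ * Real.log ((r s - rm) * (r s - rp)) = s) {s t : ℝ}
    (hst : s ≤ t) : r t - r s ≤ t - s := by
  have h1 := mul_le_mul_of_nonneg_left
    (log_mul_sub_mono hlt (hr1 s) (radius_le_radius hlt hκ hr1 hr2 hst))
    (by positivity : 0 ≤ (2 * κ)⁻¹)
  linarith [hr2 s, hr2 t]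

theorem continuous_radius {rm rp κ : ℝ} {r : ℝ → ℝ} (hlt : rm < rp) (hκ : 0 < κ)
    (hr1 : ∀ s, rp < r s)
    (hr2 : ∀ s, r s + (2 * κ)⁻¹ * Real.log ((r s - rm) * (r s - rp)) = s) : Continuous r := by
  have key : ∀ s t, s ≤ t → |r s - r t| ≤ |s - t| := by
    intro s t hst
    rw [abs_sub_comm, abs_of_nonneg (sub_nonneg.mpr (radius_le_radius hlt hκ hr1 hr2 hst)),
      abs_sub_comm s t, abs_of_nonneg (by linarith)]
    exact radius_sub_le hlt hκ hr1 hr2 hst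
  refine LipschitzWith.continuous (K := 1) (LipschitzWith.of_dist_le_mul fun s t => ?_)
  simp only [Real.dist_eq, NNReal.coe_one, one_mul]
  rcases le_total s t with h | h
  · exact key s t h
  · rw [abs_sub_comm, abs_sub_comm s t]
    exact key t s h

theorem tendsto_radius_atTop {rm rp κ : ℝ} {r : ℝ → ℝ} (hlt : rm < rp) (hκ : 0 < κ)
    (hr1 : ∀ s, rp < r s)
    (hr2 : ∀ s, r s + (2 * κ)⁻¹ * Real.log ((r s - rm) * (r s - rp)) = s) :
    Tendsto r atTop atTop := by
  refine tendsto_atTop_atTop_of_monotone (fun s t h => radius_le_radius hlt hκ hr1 hr2 h) ?_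
  intro b
  by_contra! h
  have h1 := mul_le_mul_of_nonneg_left (log_mul_sub_mono hlt
    (hr1 (b + (2 * κ)⁻¹ * Real.log ((b - rm) * (b - rp)))) (h _).le)
    (by positivity : 0 ≤ (2 * κ)⁻¹)
  linarith [hr2 (b + (2 * κ)⁻¹ * Real.log ((b - rm) * (b - rp))),
    h (b + (2 * κ)⁻¹ * Real.log ((b - rm) * (b - rp)))]

theorem hasDerivAt_radius {rm rp κ : ℝ} {r : ℝ → ℝ} (hlt : rm < rp) (hκ : 0 < κ)
    (hr1 : ∀ s, rp < r s)
    (hr2 : ∀ s, r s + (2 * κ)⁻¹ * Real.log ((r s - rm) * (r s - rp)) = s) (s : ℝ) :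
    HasDerivAt r (1 + (2 * κ)⁻¹ * ((r s - rm)⁻¹ + (r s - rp)⁻¹))⁻¹ s := by
  have h1 : 0 < r s - rp := sub_pos.mpr (hr1 s)
  have h2 : 0 < r s - rm := by linarith
  have hg : HasDerivAt (fun x => x + (2 * κ)⁻¹ * Real.log ((x - rm) * (x - rp)))
      (1 + (2 * κ)⁻¹ * ((r s - rm)⁻¹ + (r s - rp)⁻¹)) (r s) := by
    have h3 := ((hasDerivAt_id (r s)).sub_const rm).mul ((hasDerivAt_id (r s)).sub_const rp)
    have h4 := h3.log (mul_pos h2 h1).ne'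
    refine ((hasDerivAt_id (r s)).add (h4.const_mul ((2 * κ)⁻¹))).congr_deriv ?_
    simp only [Pi.mul_apply, id]
    field_simp
  exact HasDerivAt.of_local_left_inverse (continuous_radius hlt hκ hr1 hr2).continuousAt hg
    (by positivity) (Eventually.of_forall hr2)

/-- The ratio `(r - r₊) / r` decays exponentially towards the horizon. -/
theorem exists_hasDerivAt_ratio {rm rp κ : ℝ} {r : ℝ → ℝ} (hrm : 0 ≤ rm) (hlt : rm < rp)
    (hκ : 0 < κ) (hr1 : ∀ s, rp < r s)
    (hr2 : ∀ s, r s + (2 * κ)⁻¹ * Real.log ((r s - rm) * (r s - rp)) = s) (S₀ : ℝ) :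
    ∃ κ₀ : ℝ, 0 < κ₀ ∧ ∃ ρ' : ℝ → ℝ, (∀ s, HasDerivAt (fun x => (r x - rp) / r x) (ρ' s) s) ∧
      ∀ s, s ≤ S₀ → κ₀ * ((r s - rp) / r s) ≤ ρ' s := by
  have hrp : 0 < rp := by linarith
  have h0 := hr1 S₀
  refine ⟨rp * κ / (r S₀ * (κ * (r S₀ - rp) + 1)), ?_,
    fun s => rp * (1 + (2 * κ)⁻¹ * ((r s - rm)⁻¹ + (r s - rp)⁻¹))⁻¹ / r s ^ 2, ?_, ?_⟩
  · have : 0 < r S₀ - rp := by linarith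
    have : 0 < r S₀ := by linarith
    positivity
  · intro s
    have h1 := hasDerivAt_radius hlt hκ hr1 hr2 s
    have h2 : r s ≠ 0 := by linarith [hr1 s]
    refine ((h1.sub_const rp).div h1 h2).congr_deriv ?_
    ring
  · intro s hs
    have h1 : 0 < r s - rp := sub_pos.mpr (hr1 s)
    have h2 : 0 < r s - rm := by linarith
    have h3 : 0 < r s := by linarith
    have h4 := radius_le_radius hlt hκ hr1 hr2 hs
    have h7 : 0 < r S₀ := by linarith
    have h5 : κ * (r s - rp) / (κ * (r s - rp) + 1) ≤
        (1 + (2 * κ)⁻¹ * ((r s - rm)⁻¹ + (r s - rp)⁻¹))⁻¹ := by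
      rw [le_inv_comm₀ (by positivity) (by positivity), inv_div]
      have h6 : (r s - rm)⁻¹ ≤ (r s - rp)⁻¹ := inv_anti₀ h1 (by linarith)
      calc _ ≤ 1 + (2 * κ)⁻¹ * ((r s - rp)⁻¹ + (r s - rp)⁻¹) := by gcongr
        _ = _ := by field_simp; ring
    have h6 : rp * κ / (r S₀ * (κ * (r S₀ - rp) + 1)) ≤ rp * κ / (r s * (κ * (r s - rp) + 1)) := by
      gcongr
    calc _ ≤ rp * κ / (r s * (κ * (r s - rp) + 1)) * ((r s - rp) / r s) := by gcongr
      _ = rp * (κ * (r s - rp) / (κ * (r s - rp) + 1)) / r s ^ 2 := by field_simp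
      _ ≤ _ := div_le_div_of_nonneg_right (mul_le_mul_of_nonneg_left h5 hrp.le) (by positivity)

theorem Vpot_eq (M m E : ℝ) (r : ℝ → ℝ) (ω : ℝ) (L : ℕ) (s : ℝ) :
    Vpot M m E r ω L s = W0 M m E r L s + (m ^ 2 - ω ^ 2) := by
  simp only [Vpot, W0]
  ring

theorem continuous_W0 {M m E rp : ℝ} {r : ℝ → ℝ} (hrp : 0 < rp) (hr : Continuous r)
    (hr1 : ∀ s, rp < r s) (L : ℕ) : Continuous (W0 M m E r L) := by
  have h : ∀ s, r s ≠ 0 := fun s => by linarith [hr1 s]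
  have h2 : ∀ s, r s ^ 2 ≠ 0 := fun s => pow_ne_zero _ (h s)
  have h4 : ∀ s, r s ^ 4 ≠ 0 := fun s => pow_ne_zero _ (h s)
  unfold W0
  fun_prop (disch := assumption)

theorem tendsto_W0 {M m E : ℝ} {r : ℝ → ℝ} (hr : Tendsto r atTop atTop) (L : ℕ) :
    Tendsto (W0 M m E r L) atTop (nhds 0) := by
  have h1 : Tendsto (fun s => (r s)⁻¹) atTop (nhds 0) := hr.inv_tendsto_atTop
  have hc : Continuous fun x : ℝ => (1 - 2 * M * x + E ^ 2 * x ^ 2) *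
    (m ^ 2 + ((L : ℝ) * ((L : ℝ) + 1)) * x ^ 2 + (2 * M * x ^ 3 - 2 * E ^ 2 * x ^ 4)) - m ^ 2 := by
    fun_prop
  have h2 := (hc.tendsto 0).comp h1
  simp only [ne_eq, OfNat.ofNat_ne_zero, not_false_eq_true, zero_pow, mul_zero, sub_zero,
    add_zero, one_mul, sub_self] at h2
  refine h2.congr' ?_
  filter_upwards [hr.eventually_gt_atTop 0] with s hs
  simp only [Function.comp, W0]
  field_simp

theorem abs_W0_add_le {M m E rm rp : ℝ} {r : ℝ → ℝ} (hM : 0 < M) (hrm : 0 ≤ rm) (hlt : rm < rp)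
    (hsum : rm + rp = 2 * M) (hprod : rm * rp = E ^ 2) (hME : E ^ 2 ≤ M * rp)
    (hr1 : ∀ s, rp < r s) {L : ℕ} (hL : 1 ≤ L) (s : ℝ) :
    |W0 M m E r L s + m ^ 2| ≤
      (m ^ 2 + 2 / rp ^ 2 + 2 * M / rp ^ 3) * (L : ℝ) ^ 2 * ((r s - rp) / r s) := by
  have hrp : 0 < rp := by linarith
  have h := hr1 s
  set x := r s with hx
  have hx0 : 0 < x := by linarith
  have hL1 : (1 : ℝ) ≤ L := by exact_mod_cast hL
  have hF : 1 - 2 * M / x + E ^ 2 / x ^ 2 = (x - rm) / x * ((x - rp) / x) := by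
    rw [← hsum, ← hprod]
    field_simp
    ring
  have hρ : 0 < (x - rp) / x := div_pos (by linarith) hx0
  have hσ : 0 < (x - rm) / x := div_pos (by linarith) hx0
  have hσ1 : (x - rm) / x ≤ 1 := by rw [div_le_one hx0]; linarith
  have hnum : 0 ≤ 2 * M * x - 2 * E ^ 2 := by nlinarith
  have hG0 : 0 ≤ m ^ 2 + ((L : ℝ) * ((L : ℝ) + 1)) / x ^ 2 + (2 * M * x - 2 * E ^ 2) / x ^ 4 := by
    positivity
  have hG : m ^ 2 + ((L : ℝ) * ((L : ℝ) + 1)) / x ^ 2 + (2 * M * x - 2 * E ^ 2) / x ^ 4 ≤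
      (m ^ 2 + 2 / rp ^ 2 + 2 * M / rp ^ 3) * (L : ℝ) ^ 2 := by
    have hL2 : (1 : ℝ) ≤ (L : ℝ) ^ 2 := one_le_pow₀ hL1
    have h1 : m ^ 2 ≤ m ^ 2 * (L : ℝ) ^ 2 := le_mul_of_one_le_right (sq_nonneg _) hL2
    have h2 : ((L : ℝ) * ((L : ℝ) + 1)) / x ^ 2 ≤ 2 / rp ^ 2 * (L : ℝ) ^ 2 := by
      rw [div_mul_eq_mul_div]
      have : (L : ℝ) * ((L : ℝ) + 1) ≤ 2 * (L : ℝ) ^ 2 := by nlinarith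
      gcongr
    have h3 : (2 * M * x - 2 * E ^ 2) / x ^ 4 ≤ 2 * M / rp ^ 3 * (L : ℝ) ^ 2 := by
      calc (2 * M * x - 2 * E ^ 2) / x ^ 4 ≤ (2 * M * x) / x ^ 4 := by
            gcongr
            nlinarith [sq_nonneg E]
        _ = 2 * M / x ^ 3 := by field_simp
        _ ≤ 2 * M / rp ^ 3 := by gcongr
        _ ≤ _ := le_mul_of_one_le_right (by positivity) hL2
    linarith
  have hW : W0 M m E r L s + m ^ 2 = (x - rm) / x * ((x - rp) / x) *
      (m ^ 2 + ((L : ℝ) * ((L : ℝ) + 1)) / x ^ 2 + (2 * M * x - 2 * E ^ 2) / x ^ 4) := by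
    rw [← hF]
    simp only [W0, ← hx]
    ring
  rw [hW, abs_of_nonneg (by positivity)]
  calc _ ≤ 1 * ((x - rp) / x) * ((m ^ 2 + 2 / rp ^ 2 + 2 * M / rp ^ 3) * (L : ℝ) ^ 2) := by gcongr
    _ = _ := by ring

/-- A solution of `u'' - (Q - ω²) u = H`, written through `v = u' + iωu`, that is asymptotically
`c e^{-iωs}` at a horizon where the weight `ρ` degenerates exponentially. -/
structure HorizonSolution (ρ ρ' Q : ℝ → ℝ) (u v H : ℝ → ℂ) (S₀ κ₀ K l ω y : ℝ) : Prop where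
  rate_pos : 0 < κ₀
  const_nonneg : 0 ≤ K
  one_le : 1 ≤ l
  weight_pos : ∀ s, 0 < ρ s
  weight_le : ∀ s, ρ s ≤ 1
  weight_deriv : ∀ s, HasDerivAt ρ (ρ' s) s
  weight_growth : ∀ s, s ≤ S₀ → κ₀ * ρ s ≤ ρ' s
  potential_cont : Continuous Q
  potential_le : ∀ s, |Q s| ≤ K * l ^ 2 * ρ s
  source_cont : Continuous H
  deriv_u : ∀ s, HasDerivAt u (v s - Complex.I * ω * u s) s
  deriv_v : ∀ s, HasDerivAt v (Complex.I * ω * v s + Q s * u s + H s) s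
  tendsto_v : Tendsto v atBot (nhds 0)
  tendsto_u : Tendsto (fun s => ‖u s‖ ^ 2) atBot (nhds y)

theorem sq_integral_le_mul {ρ h : ℝ → ℝ} {a b : ℝ} (hab : a ≤ b) (hρ : Continuous ρ)
    (hpos : ∀ s, 0 < ρ s) (hh : Continuous h) :
    (∫ s in a..b, h s) ^ 2 ≤ (∫ s in a..b, ρ s) * ∫ s in a..b, h s ^ 2 / ρ s := by
  have hne : ∀ s, ρ s ≠ 0 := fun s => (hpos s).ne'
  have hc : Continuous fun s => h s ^ 2 / ρ s := by fun_prop (disch := assumption)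
  have key : ∀ x : ℝ, 0 ≤ (∫ s in a..b, ρ s) * (x * x) + (2 * ∫ s in a..b, h s) * x
      + ∫ s in a..b, h s ^ 2 / ρ s := by
    intro x
    have h1 : 0 ≤ ∫ s in a..b, (x * x * ρ s + 2 * x * h s + h s ^ 2 / ρ s) := by
      refine intervalIntegral.integral_nonneg hab fun s _ => ?_
      have h2 := hpos s
      have : x * x * ρ s + 2 * x * h s + h s ^ 2 / ρ s = (x * ρ s + h s) ^ 2 / ρ s := by
        field_simp
        ring
      rw [this]
      positivity
    rw [intervalIntegral.integral_add, intervalIntegral.integral_add,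
      intervalIntegral.integral_const_mul, intervalIntegral.integral_const_mul] at h1
    · linarith
    all_goals
      refine Continuous.intervalIntegrable ?_ _ _
      fun_prop
  have := discrim_le_zero key
  rw [discrim] at this
  linarith

namespace HorizonSolution

variable {ρ ρ' Q : ℝ → ℝ} {u v H : ℝ → ℂ} {S₀ κ₀ K l ω y : ℝ}

theorem continuous_weight (d : HorizonSolution ρ ρ' Q u v H S₀ κ₀ K l ω y) : Continuous ρ :=
  continuous_iff_continuousAt.mpr fun s => (d.weight_deriv s).continuousAt

theorem continuous_u (d : HorizonSolution ρ ρ' Q u v H S₀ κ₀ K l ω y) : Continuous u :=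
  continuous_iff_continuousAt.mpr fun s => (d.deriv_u s).continuousAt

theorem continuous_v (d : HorizonSolution ρ ρ' Q u v H S₀ κ₀ K l ω y) : Continuous v :=
  continuous_iff_continuousAt.mpr fun s => (d.deriv_v s).continuousAt

theorem continuous_div (d : HorizonSolution ρ ρ' Q u v H S₀ κ₀ K l ω y) {h : ℝ → ℂ}
    (hh : Continuous h) : Continuous fun s => ‖h s‖ ^ 2 / ρ s := by
  have := d.continuous_weight
  have hne : ∀ s, ρ s ≠ 0 := fun s => (d.weight_pos s).ne'
  fun_prop (disch := assumption)

theorem integral_weight_le (d : HorizonSolution ρ ρ' Q u v H S₀ κ₀ K l ω y) {a b : ℝ}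
    (hab : a ≤ b) (hb : b ≤ S₀) : ∫ s in a..b, ρ s ≤ ρ b / κ₀ := by
  have hd : ∀ s, HasDerivAt (fun s => ρ s / κ₀ - ∫ t in a..s, ρ t) (ρ' s / κ₀ - ρ s) s := fun s =>
    ((d.weight_deriv s).div_const κ₀).sub
      (d.continuous_weight.integral_hasStrictDerivAt a s).hasDerivAt
  have hm : MonotoneOn (fun s => ρ s / κ₀ - ∫ t in a..s, ρ t) (Icc a b) := by
    refine monotoneOn_of_deriv_nonneg (convex_Icc _ _)
      (fun s _ => (hd s).continuousAt.continuousWithinAt)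
      (fun s _ => (hd s).differentiableAt.differentiableWithinAt) fun s hs => ?_
    rw [interior_Icc] at hs
    rw [(hd s).deriv, sub_nonneg, le_div_iff₀ d.rate_pos, mul_comm]
    exact d.weight_growth s (hs.2.le.trans hb)
  have h := hm (left_mem_Icc.mpr hab) (right_mem_Icc.mpr hab) hab
  simp only [intervalIntegral.integral_same] at h
  have := div_pos (d.weight_pos a) d.rate_pos
  linarith

theorem tendsto_weight (d : HorizonSolution ρ ρ' Q u v H S₀ κ₀ K l ω y) :
    Tendsto ρ atBot (nhds 0) := by
  have hd : ∀ s, HasDerivAt (fun s => ρ s * Real.exp (-(κ₀ * s)))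
      ((ρ' s - κ₀ * ρ s) * Real.exp (-(κ₀ * s))) s := fun s => by
    refine ((d.weight_deriv s).mul ((hasDerivAt_id s).const_mul κ₀).neg.exp).congr_deriv ?_
    simp only [id, Pi.neg_apply]
    ring
  have hm : MonotoneOn (fun s => ρ s * Real.exp (-(κ₀ * s))) (Iic S₀) := by
    refine monotoneOn_of_deriv_nonneg (convex_Iic _)
      (fun s _ => (hd s).continuousAt.continuousWithinAt)
      (fun s _ => (hd s).differentiableAt.differentiableWithinAt) fun s hs => ?_
    rw [interior_Iic] at hs
    rw [(hd s).deriv]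
    exact mul_nonneg (sub_nonneg.mpr (d.weight_growth s (le_of_lt hs))) (Real.exp_pos _).le
  have h1 : Tendsto (fun s => ρ S₀ * Real.exp (-(κ₀ * S₀)) * Real.exp (κ₀ * s)) atBot (nhds 0) := by
    have : Tendsto (fun s : ℝ => κ₀ * s) atBot atBot := tendsto_id.const_mul_atBot d.rate_pos
    simpa using (Real.tendsto_exp_atBot.comp this).const_mul (ρ S₀ * Real.exp (-(κ₀ * S₀)))
  refine squeeze_zero' (Eventually.of_forall fun s => (d.weight_pos s).le) ?_ h1
  filter_upwards [eventually_le_atBot S₀] with s hs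
  have h2 := hm hs (mem_Iic.mpr le_rfl : S₀ ∈ Iic S₀) hs
  simp only at h2
  calc ρ s = ρ s * Real.exp (-(κ₀ * s)) * Real.exp (κ₀ * s) := by
        rw [mul_assoc, ← Real.exp_add]; simp
    _ ≤ _ := by gcongr

theorem exists_norm_le (d : HorizonSolution ρ ρ' Q u v H S₀ κ₀ K l ω y) :
    ∃ U : ℝ, 0 ≤ U ∧ ∀ s, s ≤ S₀ → ‖u s‖ ≤ U := by
  have h1 : ∀ᶠ s in atBot, ‖u s‖ ^ 2 < y + 1 := d.tendsto_u.eventually (gt_mem_nhds (by linarith))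
  obtain ⟨b, hb⟩ := eventually_atBot.mp h1
  obtain ⟨U, hU⟩ := isCompact_Icc.exists_bound_of_continuousOn (s := Icc b S₀)
    d.continuous_u.continuousOn
  refine ⟨max (Real.sqrt (y + 1)) U, (Real.sqrt_nonneg _).trans (le_max_left _ _), fun s hs => ?_⟩
  rcases le_total s b with h | h
  · exact (Real.le_sqrt_of_sq_le (hb s h).le).trans (le_max_left _ _)
  · exact (hU s ⟨h, hs⟩).trans (le_max_right _ _)

theorem integral_norm_source_le (d : HorizonSolution ρ ρ' Q u v H S₀ κ₀ K l ω y) {N a b : ℝ}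
    (hN : ∀ a b, a ≤ b → b ≤ S₀ → ∫ s in a..b, ‖H s‖ ^ 2 / ρ s ≤ N) (hab : a ≤ b) (hb : b ≤ S₀) :
    ∫ s in a..b, ‖H s‖ ≤ Real.sqrt (ρ b * (N / κ₀)) := by
  refine Real.le_sqrt_of_sq_le ?_
  have h1 := sq_integral_le_mul hab d.continuous_weight d.weight_pos d.source_cont.norm
  have h2 : 0 ≤ ∫ s in a..b, ‖H s‖ ^ 2 / ρ s :=
    intervalIntegral.integral_nonneg hab fun s _ => div_nonneg (sq_nonneg _) (d.weight_pos s).le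
  have h3 := div_pos (d.weight_pos b) d.rate_pos
  calc _ ≤ _ := h1
    _ ≤ ρ b / κ₀ * N := mul_le_mul (d.integral_weight_le hab hb) (hN a b hab hb) h2 h3.le
    _ = _ := by ring

theorem norm_sub_exp_smul_le (d : HorizonSolution ρ ρ' Q u v H S₀ κ₀ K l ω y) {N U a b : ℝ}
    (hN : ∀ a b, a ≤ b → b ≤ S₀ → ∫ s in a..b, ‖H s‖ ^ 2 / ρ s ≤ N)
    (hU : ∀ s, s ≤ S₀ → ‖u s‖ ≤ U) (hab : a ≤ b) (hb : b ≤ S₀) :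
    ‖v b‖ ≤ ‖v a‖ + (K * l ^ 2 * U / κ₀ * ρ b + Real.sqrt (ρ b * (N / κ₀))) := by
  have hU0 : 0 ≤ U := (norm_nonneg _).trans (hU b hb)
  have hcu := d.continuous_u
  have hcQ := d.potential_cont
  have hcH := d.source_cont
  have hcρ := d.continuous_weight
  have hK := d.const_nonneg
  have hne : ∀ s : ℝ, ‖Complex.exp (-(Complex.I * ω * s))‖ = 1 := fun s => by
    rw [Complex.norm_exp]; simp
  have hd : ∀ s ∈ uIcc a b, HasDerivAt (fun s : ℝ => Complex.exp (-(Complex.I * ω * s)) * v s)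
      (Complex.exp (-(Complex.I * ω * s)) * (Q s * u s + H s)) s := by
    intro s _
    have h1 : HasDerivAt (fun s : ℝ => Complex.exp (-(Complex.I * ω * s)))
        (Complex.exp (-(Complex.I * ω * s)) * (-(Complex.I * ω * 1))) s :=
      ((Complex.ofRealCLM.hasDerivAt (x := s)).const_mul (Complex.I * ω)).neg.cexp
    refine (h1.mul (d.deriv_v s)).congr_deriv ?_
    ring
  have hcont : Continuous fun s : ℝ => Complex.exp (-(Complex.I * ω * s)) * (Q s * u s + H s) := by
    fun_prop
  have hI := intervalIntegral.integral_eq_sub_of_hasDerivAt hd (hcont.intervalIntegrable a b)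
  have hg : Continuous fun s => K * l ^ 2 * U * ρ s + ‖H s‖ := by fun_prop
  have hle : ‖∫ s in a..b, Complex.exp (-(Complex.I * ω * s)) * (Q s * u s + H s)‖ ≤
      ∫ s in a..b, (K * l ^ 2 * U * ρ s + ‖H s‖) := by
    refine intervalIntegral.norm_integral_le_of_norm_le hab ?_ (hg.intervalIntegrable a b)
    refine Eventually.of_forall fun s hs => ?_
    rw [norm_mul, hne, one_mul]
    refine (norm_add_le _ _).trans (add_le_add ?_ le_rfl)
    rw [norm_mul, Complex.norm_real, Real.norm_eq_abs]
    calc |Q s| * ‖u s‖ ≤ (K * l ^ 2 * ρ s) * U := by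
          have := d.weight_pos s
          exact mul_le_mul (d.potential_le s) (hU s (hs.2.trans hb)) (norm_nonneg _) (by positivity)
      _ = _ := by ring
  rw [intervalIntegral.integral_add ((hcρ.const_mul _).intervalIntegrable a b)
    (hcH.norm.intervalIntegrable a b), intervalIntegral.integral_const_mul] at hle
  have h1 : K * l ^ 2 * U * ∫ s in a..b, ρ s ≤ K * l ^ 2 * U * (ρ b / κ₀) :=
    mul_le_mul_of_nonneg_left (d.integral_weight_le hab hb) (by positivity)
  have h2 := d.integral_norm_source_le hN hab hb
  have h3 : ‖v b‖ = ‖Complex.exp (-(Complex.I * ω * b)) * v b‖ := by rw [norm_mul, hne, one_mul]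
  have h4 : ‖v a‖ = ‖Complex.exp (-(Complex.I * ω * a)) * v a‖ := by rw [norm_mul, hne, one_mul]
  rw [h3, h4, ← sub_add_cancel (Complex.exp (-(Complex.I * ω * b)) * v b)
    (Complex.exp (-(Complex.I * ω * a)) * v a), ← hI, add_comm]
  refine (norm_add_le _ _).trans (add_le_add le_rfl (hle.trans ?_))
  calc _ ≤ K * l ^ 2 * U * (ρ b / κ₀) + Real.sqrt (ρ b * (N / κ₀)) := add_le_add h1 h2
    _ = _ := by ring

theorem norm_sq_div_le (d : HorizonSolution ρ ρ' Q u v H S₀ κ₀ K l ω y) {N U s : ℝ} (hN0 : 0 ≤ N)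
    (hN : ∀ a b, a ≤ b → b ≤ S₀ → ∫ s in a..b, ‖H s‖ ^ 2 / ρ s ≤ N)
    (hU : ∀ s, s ≤ S₀ → ‖u s‖ ≤ U) (hs : s ≤ S₀) :
    ‖v s‖ ^ 2 / ρ s ≤ 2 * (K * l ^ 2 * U / κ₀) ^ 2 * ρ s + 2 * N / κ₀ := by
  have h1 : ‖v s‖ ≤ K * l ^ 2 * U / κ₀ * ρ s + Real.sqrt (ρ s * (N / κ₀)) := by
    have h2 := d.tendsto_v.norm.add_const
      (K * l ^ 2 * U / κ₀ * ρ s + Real.sqrt (ρ s * (N / κ₀)))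
    rw [norm_zero, zero_add] at h2
    refine ge_of_tendsto h2 ?_
    filter_upwards [eventually_le_atBot s] with a ha
    exact d.norm_sub_exp_smul_le hN hU ha hs
  have hρ := d.weight_pos s
  have hκ := d.rate_pos
  have h3 : Real.sqrt (ρ s * (N / κ₀)) ^ 2 = ρ s * (N / κ₀) := Real.sq_sqrt (by positivity)
  rw [div_le_iff₀ hρ]
  calc ‖v s‖ ^ 2 ≤ (K * l ^ 2 * U / κ₀ * ρ s + Real.sqrt (ρ s * (N / κ₀))) ^ 2 := by gcongr
    _ ≤ 2 * ((K * l ^ 2 * U / κ₀ * ρ s) ^ 2 + Real.sqrt (ρ s * (N / κ₀)) ^ 2) := add_sq_le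
    _ = _ := by rw [h3]; ring

theorem energy_le (d : HorizonSolution ρ ρ' Q u v H S₀ κ₀ K l ω y) {N a s : ℝ}
    (hN : ∀ a b, a ≤ b → b ≤ S₀ → ∫ s in a..b, ‖H s‖ ^ 2 / ρ s ≤ N) (has : a ≤ s) (hs : s ≤ S₀) :
    Real.exp (-(2 * (K + 1) / κ₀ * l)) * (‖v s‖ ^ 2 / ρ s + l ^ 2 * ‖u s‖ ^ 2
      + κ₀ / 2 * ∫ t in a..s, ‖v t‖ ^ 2 / ρ t) ≤
      ‖v a‖ ^ 2 / ρ a + l ^ 2 * ‖u a‖ ^ 2 + 2 / κ₀ * N := by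
  have hκ := d.rate_pos
  have hK := d.const_nonneg
  have hl := d.one_le
  set c := 2 * (K + 1) / κ₀ with hc
  have hc0 : 0 ≤ c := by positivity
  set A : ℝ → ℝ := fun t => ‖v t‖ ^ 2 / ρ t with hA
  set h : ℝ → ℝ := fun t => ‖H t‖ ^ 2 / ρ t with hh
  set Z : ℝ → ℝ := fun t => A t + l ^ 2 * ‖u t‖ ^ 2 with hZ
  set θ : ℝ → ℝ := fun t => Real.exp (-(c * l * Real.sqrt (ρ t))) with hθ
  have hAc : Continuous A := d.continuous_div d.continuous_v
  have hhc : Continuous h := d.continuous_div d.source_cont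
  have hA0 : ∀ t, 0 ≤ A t := fun t => div_nonneg (sq_nonneg _) (d.weight_pos t).le
  have hh0 : ∀ t, 0 ≤ h t := fun t => div_nonneg (sq_nonneg _) (d.weight_pos t).le
  have hZ0 : ∀ t, 0 ≤ Z t := fun t => add_nonneg (hA0 t) (by positivity)
  have hθ1 : ∀ t, θ t ≤ 1 := fun t => Real.exp_le_one_iff.mpr (by
    have := Real.sqrt_nonneg (ρ t); have : 0 ≤ c * l * Real.sqrt (ρ t) := by positivity
    linarith)
  have hθ2 : ∀ t, Real.exp (-(c * l)) ≤ θ t := fun t => Real.exp_le_exp.mpr (by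
    have h1 : Real.sqrt (ρ t) ≤ 1 := Real.sqrt_le_one.mpr (d.weight_le t)
    have : 0 ≤ c * l := by positivity
    nlinarith)
  have hZd : ∀ t, ∃ Z', HasDerivAt Z Z' t ∧
      (t ≤ S₀ → Z' ≤ (K + 1) * l * Real.sqrt (ρ t) * Z t - κ₀ / 2 * A t + 2 / κ₀ * h t) := by
    intro t
    refine ⟨_, ((d.deriv_v t).norm_sq.div (d.weight_deriv t) (d.weight_pos t).ne').add
      ((d.deriv_u t).norm_sq.const_mul (l ^ 2)), fun ht => ?_⟩
    have hρ := d.weight_pos t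
    set η := Real.sqrt (ρ t) with hη
    have hη0 : 0 < η := Real.sqrt_pos.mpr hρ
    have hη2 : η ^ 2 = ρ t := Real.sq_sqrt hρ.le
    have hI : ∀ w : ℂ, inner ℝ w (Complex.I * ω * w) = 0 := fun w => by
      simp [Complex.inner]
      ring
    have h1 : inner ℝ (v t) (Complex.I * ω * v t + Q t * u t + H t) ≤
        ‖v t‖ * (K * l ^ 2 * ρ t * ‖u t‖ + ‖H t‖) := by
      rw [add_assoc, inner_add_right, hI, zero_add]
      refine (real_inner_le_norm _ _).trans (mul_le_mul_of_nonneg_left ?_ (norm_nonneg _))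
      refine (norm_add_le _ _).trans (add_le_add ?_ le_rfl)
      rw [norm_mul, Complex.norm_real, Real.norm_eq_abs]
      exact mul_le_mul_of_nonneg_right (d.potential_le t) (norm_nonneg _)
    have h2 : inner ℝ (u t) (v t - Complex.I * ω * u t) ≤ ‖u t‖ * ‖v t‖ := by
      rw [inner_sub_right, hI, sub_zero]
      exact real_inner_le_norm _ _
    have h3 := d.weight_growth t ht
    have hv : ‖v t‖ = ‖v t‖ / η * η := by field_simp
    have hH : ‖H t‖ = ‖H t‖ / η * η := by field_simp
    have hAx : A t = (‖v t‖ / η) ^ 2 := by simp only [hA]; rw [div_pow, hη2]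
    have hhx : h t = (‖H t‖ / η) ^ 2 := by simp only [hh]; rw [div_pow, hη2]
    have e1 : (2 * inner ℝ (v t) (Complex.I * ω * v t + Q t * u t + H t) * ρ t -
        ‖v t‖ ^ 2 * ρ' t) / ρ t ^ 2 ≤
        2 * (‖v t‖ * (K * l ^ 2 * ρ t * ‖u t‖ + ‖H t‖)) / ρ t - κ₀ * A t := by
      have : 2 * (‖v t‖ * (K * l ^ 2 * ρ t * ‖u t‖ + ‖H t‖)) / ρ t - κ₀ * A t =
          (2 * (‖v t‖ * (K * l ^ 2 * ρ t * ‖u t‖ + ‖H t‖)) * ρ t - ‖v t‖ ^ 2 * (κ₀ * ρ t))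
          / ρ t ^ 2 := by
        simp only [hA]; field_simp
      rw [this]
      gcongr
    have e2 : 2 * (‖v t‖ * (K * l ^ 2 * ρ t * ‖u t‖ + ‖H t‖)) / ρ t =
        2 * (‖v t‖ / η) * K * l ^ 2 * ‖u t‖ * η + 2 * (‖v t‖ / η) * (‖H t‖ / η) := by
      rw [← hη2]; field_simp
    have e3 : l ^ 2 * (2 * inner ℝ (u t) (v t - Complex.I * ω * u t)) ≤
        2 * l ^ 2 * ‖u t‖ * (‖v t‖ / η) * η := by
      have : 2 * l ^ 2 * ‖u t‖ * (‖v t‖ / η) * η = l ^ 2 * (2 * (‖u t‖ * ‖v t‖)) := by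
        field_simp
      rw [this]
      gcongr
    refine (add_le_add e1 e3).trans ?_
    rw [e2]
    simp only [hZ]
    rw [hAx, hhx]
    set x := ‖v t‖ / η
    set w := ‖H t‖ / η
    set z := ‖u t‖
    have i1 : 2 * x * w ≤ κ₀ / 2 * x ^ 2 + 2 / κ₀ * w ^ 2 := by
      have : 0 ≤ (κ₀ * x - 2 * w) ^ 2 / (2 * κ₀) := by positivity
      have e : (κ₀ * x - 2 * w) ^ 2 / (2 * κ₀) = κ₀ / 2 * x ^ 2 + 2 / κ₀ * w ^ 2 - 2 * x * w := by
        field_simp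
        ring
      linarith
    have i2 : 0 ≤ (K + 1) * l * η * (x - l * z) ^ 2 := by positivity
    nlinarith [i1, i2]
  choose Z' hZ' hZle using hZd
  have hηd : ∀ t, HasDerivAt (fun t => Real.sqrt (ρ t)) (ρ' t / (2 * Real.sqrt (ρ t))) t := fun t =>
    (d.weight_deriv t).sqrt (d.weight_pos t).ne'
  have hθd : ∀ t, HasDerivAt θ (θ t * -(c * l * (ρ' t / (2 * Real.sqrt (ρ t))))) t := fun t =>
    ((hηd t).const_mul (c * l)).neg.exp
  have hΦ : ∀ t, HasDerivAt (fun t => θ t * Z t +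
      Real.exp (-(c * l)) * (κ₀ / 2) * (∫ x in a..t, A x) - 2 / κ₀ * ∫ x in a..t, h x)
      (θ t * -(c * l * (ρ' t / (2 * Real.sqrt (ρ t)))) * Z t + θ t * Z' t +
      Real.exp (-(c * l)) * (κ₀ / 2) * A t - 2 / κ₀ * h t) t := fun t =>
    (((hθd t).mul (hZ' t)).add
      ((hAc.integral_hasStrictDerivAt a t).hasDerivAt.const_mul _)).sub
      ((hhc.integral_hasStrictDerivAt a t).hasDerivAt.const_mul _)
  have hanti : AntitoneOn (fun t => θ t * Z t +
      Real.exp (-(c * l)) * (κ₀ / 2) * (∫ x in a..t, A x) - 2 / κ₀ * ∫ x in a..t, h x)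
      (Icc a s) := by
    refine antitoneOn_of_deriv_nonpos (convex_Icc _ _)
      (fun t _ => (hΦ t).continuousAt.continuousWithinAt)
      (fun t _ => (hΦ t).differentiableAt.differentiableWithinAt) fun t ht => ?_
    rw [interior_Icc] at ht
    rw [(hΦ t).deriv]
    have htS : t ≤ S₀ := ht.2.le.trans hs
    have hρ := d.weight_pos t
    have hη0 : 0 < Real.sqrt (ρ t) := Real.sqrt_pos.mpr hρ
    have hη2 : Real.sqrt (ρ t) * Real.sqrt (ρ t) = ρ t := Real.mul_self_sqrt hρ.le
    have hθ0 : 0 < θ t := Real.exp_pos _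
    have j1 : (K + 1) * l * Real.sqrt (ρ t) ≤ c * l * (ρ' t / (2 * Real.sqrt (ρ t))) := by
      have : κ₀ / 2 * Real.sqrt (ρ t) ≤ ρ' t / (2 * Real.sqrt (ρ t)) := by
        rw [le_div_iff₀ (by positivity)]
        nlinarith [d.weight_growth t htS]
      calc (K + 1) * l * Real.sqrt (ρ t) = c * l * (κ₀ / 2 * Real.sqrt (ρ t)) := by
            rw [hc]; field_simp
        _ ≤ _ := by gcongr
    have j2 := mul_le_mul_of_nonneg_right j1 (hZ0 t)
    have j3 := mul_le_mul_of_nonneg_left (add_le_add (hZle t htS) (neg_le_neg j2)) hθ0.le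
    have j4 : Real.exp (-(c * l)) * (κ₀ / 2) * A t ≤ θ t * (κ₀ / 2 * A t) := by
      rw [mul_assoc]
      exact mul_le_mul_of_nonneg_right (hθ2 t) (mul_nonneg (by positivity) (hA0 t))
    have j5 : θ t * (2 / κ₀ * h t) ≤ 2 / κ₀ * h t :=
      mul_le_of_le_one_left (mul_nonneg (by positivity) (hh0 t)) (hθ1 t)
    nlinarith [j3, j4, j5]
  have hfin := hanti (left_mem_Icc.mpr has) (right_mem_Icc.mpr has) has
  simp only [intervalIntegral.integral_same, mul_zero, add_zero, sub_zero] at hfin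
  have k1 : θ a * Z a ≤ Z a := mul_le_of_le_one_left (hZ0 a) (hθ1 a)
  have k2 : Real.exp (-(c * l)) * Z s ≤ θ s * Z s := mul_le_mul_of_nonneg_right (hθ2 s) (hZ0 s)
  have k3 : 2 / κ₀ * ∫ x in a..s, h x ≤ 2 / κ₀ * N :=
    mul_le_mul_of_nonneg_left (hN a s has hs) (by positivity)
  change Real.exp (-(c * l)) * (Z s + κ₀ / 2 * ∫ t in a..s, A t) ≤ Z a + 2 / κ₀ * N
  linarith

theorem energy_le_of_limit (d : HorizonSolution ρ ρ' Q u v H S₀ κ₀ K l ω y) {N a s : ℝ}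
    (hN0 : 0 ≤ N) (hN : ∀ a b, a ≤ b → b ≤ S₀ → ∫ s in a..b, ‖H s‖ ^ 2 / ρ s ≤ N) (has : a ≤ s)
    (hs : s ≤ S₀) :
    ‖v s‖ ^ 2 / ρ s + l ^ 2 * ‖u s‖ ^ 2 + κ₀ / 2 * ∫ t in a..s, ‖v t‖ ^ 2 / ρ t ≤
      Real.exp (2 * (K + 1) / κ₀ * l) * (l ^ 2 * y + 4 / κ₀ * N) := by
  have hκ := d.rate_pos
  obtain ⟨U, hU0, hU⟩ := d.exists_norm_le
  set T := ‖v s‖ ^ 2 / ρ s + l ^ 2 * ‖u s‖ ^ 2 + κ₀ / 2 * ∫ t in a..s, ‖v t‖ ^ 2 / ρ t with hT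
  have hlim : Tendsto (fun b => 2 * (K * l ^ 2 * U / κ₀) ^ 2 * ρ b + 2 * N / κ₀ +
      l ^ 2 * ‖u b‖ ^ 2 + 2 / κ₀ * N) atBot
      (nhds (2 * (K * l ^ 2 * U / κ₀) ^ 2 * 0 + 2 * N / κ₀ + l ^ 2 * y + 2 / κ₀ * N)) :=
    (((d.tendsto_weight.const_mul _).add_const _).add (d.tendsto_u.const_mul _)).add_const _
  have h1 : Real.exp (-(2 * (K + 1) / κ₀ * l)) * T ≤ l ^ 2 * y + 4 / κ₀ * N := by
    have e : 2 * (K * l ^ 2 * U / κ₀) ^ 2 * 0 + 2 * N / κ₀ + l ^ 2 * y + 2 / κ₀ * N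
        = l ^ 2 * y + 4 / κ₀ * N := by ring
    rw [e] at hlim
    refine ge_of_tendsto hlim ?_
    filter_upwards [eventually_le_atBot a] with b hb
    have h2 := d.energy_le hN (hb.trans has) hs
    have h3 := d.norm_sq_div_le hN0 hN hU ((hb.trans has).trans hs)
    have h4 : ∫ t in a..s, ‖v t‖ ^ 2 / ρ t ≤ ∫ t in b..s, ‖v t‖ ^ 2 / ρ t :=
      intervalIntegral.integral_mono_interval hb has le_rfl
        (Eventually.of_forall fun t => div_nonneg (sq_nonneg _) (d.weight_pos t).le)
        ((d.continuous_div d.continuous_v).intervalIntegrable _ _)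
    have h5 : Real.exp (-(2 * (K + 1) / κ₀ * l)) * T ≤ Real.exp (-(2 * (K + 1) / κ₀ * l)) *
        (‖v s‖ ^ 2 / ρ s + l ^ 2 * ‖u s‖ ^ 2 + κ₀ / 2 * ∫ t in b..s, ‖v t‖ ^ 2 / ρ t) := by
      rw [hT]
      gcongr
    linarith
  calc T = Real.exp (2 * (K + 1) / κ₀ * l) * (Real.exp (-(2 * (K + 1) / κ₀ * l)) * T) := by
        rw [← mul_assoc, ← Real.exp_add]; simp
    _ ≤ _ := by gcongr

/-- Conservation of flux bounds the horizon amplitude by the source when no flux crosses `S₀`. -/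
theorem amplitude_le (d : HorizonSolution ρ ρ' Q u v H S₀ κ₀ K l ω y) {N : ℝ} (hω : 0 < ω)
    (hN0 : 0 ≤ N) (hN : ∀ a b, a ≤ b → b ≤ S₀ → ∫ s in a..b, ‖H s‖ ^ 2 / ρ s ≤ N)
    (hflux : (starRingEnd ℂ (u S₀) * (v S₀ - Complex.I * ω * u S₀)).im = 0) :
    y ≤ (4 / κ₀ + 2 * (Real.exp (2 * (K + 1) / κ₀ * l) / κ₀) / ω ^ 2) * N := by
  have hκ := d.rate_pos
  have hl := d.one_le
  have hy : 0 ≤ y := ge_of_tendsto d.tendsto_u (Eventually.of_forall fun s => sq_nonneg _)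
  have hcu := d.continuous_u
  have hcH := d.source_cont
  set X := Real.sqrt (Real.exp (2 * (K + 1) / κ₀ * l) * (y + 4 / κ₀ * N)) with hX
  have hUX : ∀ s, s ≤ S₀ → ‖u s‖ ≤ X := by
    intro s hs
    refine Real.le_sqrt_of_sq_le ?_
    have h1 := d.energy_le_of_limit hN0 hN (le_refl s) hs
    rw [intervalIntegral.integral_same, mul_zero, add_zero] at h1
    have h2 : 0 ≤ ‖v s‖ ^ 2 / ρ s := div_nonneg (sq_nonneg _) (d.weight_pos s).le
    have hl2 : 1 ≤ l ^ 2 := one_le_pow₀ hl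
    have h3 : l ^ 2 * y + 4 / κ₀ * N ≤ l ^ 2 * (y + 4 / κ₀ * N) := by
      have : 0 ≤ 4 / κ₀ * N := by positivity
      nlinarith
    have h4 := mul_le_mul_of_nonneg_left h3 (Real.exp_pos (2 * (K + 1) / κ₀ * l)).le
    have h5 : l ^ 2 * ‖u s‖ ^ 2 ≤
        l ^ 2 * (Real.exp (2 * (K + 1) / κ₀ * l) * (y + 4 / κ₀ * N)) := by linarith
    exact le_of_mul_le_mul_left h5 (by positivity)
  have hX0 : 0 ≤ X := Real.sqrt_nonneg _
  set f : ℝ → ℝ := fun s => (starRingEnd ℂ (u s) * (v s - Complex.I * ω * u s)).im with hf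
  have hfd : ∀ s, HasDerivAt f (starRingEnd ℂ (u s) * H s).im s := by
    intro s
    have h1 : HasDerivAt (fun s => starRingEnd ℂ (u s))
        (starRingEnd ℂ (v s - Complex.I * ω * u s)) s := (d.deriv_u s).star
    have h2 := h1.mul ((d.deriv_v s).sub ((d.deriv_u s).const_mul (Complex.I * ω)))
    have h3 := Complex.imCLM.hasFDerivAt.comp_hasDerivAt s h2
    refine h3.congr_deriv ?_
    simp only [Complex.imCLM_apply]
    simp
    ring
  have hbound : ∀ s, s ≤ S₀ → |f s| ≤ X * Real.sqrt (N / κ₀) := by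
    intro s hs
    have hI := intervalIntegral.integral_eq_sub_of_hasDerivAt (a := s) (b := S₀)
      (fun x _ => hfd x) (Continuous.intervalIntegrable (by fun_prop) _ _)
    have h0 : f S₀ = 0 := hflux
    rw [h0, zero_sub] at hI
    rw [← abs_neg, ← hI, ← Real.norm_eq_abs]
    have h1 : ‖∫ x in s..S₀, (starRingEnd ℂ (u x) * H x).im‖ ≤ ∫ x in s..S₀, X * ‖H x‖ := by
      refine intervalIntegral.norm_integral_le_of_norm_le hs ?_
        (Continuous.intervalIntegrable (by fun_prop) _ _)
      refine Eventually.of_forall fun x hx => ?_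
      rw [Real.norm_eq_abs]
      refine (Complex.abs_im_le_norm _).trans ?_
      rw [norm_mul, RCLike.norm_conj]
      exact mul_le_mul_of_nonneg_right (hUX x hx.2) (norm_nonneg _)
    rw [intervalIntegral.integral_const_mul] at h1
    refine h1.trans (mul_le_mul_of_nonneg_left ?_ hX0)
    refine (d.integral_norm_source_le hN hs le_rfl).trans (Real.sqrt_le_sqrt ?_)
    exact mul_le_of_le_one_left (by positivity) (d.weight_le _)
  have hlim : Tendsto f atBot (nhds (-(ω * y))) := by
    have h1 : Tendsto (fun s => (starRingEnd ℂ (u s) * v s).im) atBot (nhds 0) := by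
      have h2 : Tendsto (fun s => X * ‖v s‖) atBot (nhds 0) := by
        simpa using d.tendsto_v.norm.const_mul X
      refine squeeze_zero_norm' ?_ h2
      filter_upwards [eventually_le_atBot S₀] with s hs
      rw [Real.norm_eq_abs]
      refine (Complex.abs_im_le_norm _).trans ?_
      rw [norm_mul, RCLike.norm_conj]
      exact mul_le_mul_of_nonneg_right (hUX s hs) (norm_nonneg _)
    have h3 := h1.sub (d.tendsto_u.const_mul ω)
    rw [zero_sub] at h3
    refine h3.congr fun s => ?_
    simp only [hf]
    rw [← Complex.normSq_eq_norm_sq, Complex.normSq_apply]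
    simp
    ring
  have hmain : ω * y ≤ X * Real.sqrt (N / κ₀) := by
    have h1 : |-(ω * y)| ≤ X * Real.sqrt (N / κ₀) := by
      refine le_of_tendsto hlim.abs ?_
      filter_upwards [eventually_le_atBot S₀] with s hs using hbound s hs
    rwa [abs_neg, abs_of_nonneg (by positivity)] at h1
  have hsq : ω ^ 2 * y ^ 2 ≤ Real.exp (2 * (K + 1) / κ₀ * l) / κ₀ * N * (y + 4 / κ₀ * N) := by
    have h1 : (ω * y) ^ 2 ≤ (X * Real.sqrt (N / κ₀)) ^ 2 := by gcongr
    rw [mul_pow, mul_pow, hX, Real.sq_sqrt (by positivity), Real.sq_sqrt (by positivity)] at h1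
    refine h1.trans (le_of_eq ?_)
    ring
  set P := Real.exp (2 * (K + 1) / κ₀ * l) / κ₀ with hP
  have hP0 : 0 < P := by positivity
  rw [add_mul]
  rcases le_total y (4 / κ₀ * N) with h | h
  · have : 0 ≤ 2 * P / ω ^ 2 * N := by positivity
    linarith
  · have h4 : 0 ≤ 4 / κ₀ * N := by positivity
    rcases hy.eq_or_lt with hy0 | hy0
    · rw [← hy0]; positivity
    · have h2 : y * (ω ^ 2 * y) ≤ y * (2 * P * N) := by
        have : P * N * (y + 4 / κ₀ * N) ≤ P * N * (2 * y) := by gcongr; linarith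
        linarith
      have h3 := le_of_mul_le_mul_left h2 hy0
      have h5 : y ≤ 2 * P / ω ^ 2 * N := by
        rw [div_mul_eq_mul_div, le_div_iff₀ (by positivity)]
        linarith
      linarith

end HorizonSolution

theorem lintegral_Ioi_le_of_intervalIntegral_le {g : ℝ → ℝ} {a K : ℝ} (hg : Continuous g)
    (h0 : ∀ s, 0 ≤ g s) (hK : ∀ R, a ≤ R → ∫ s in a..R, g s ≤ K) :
    ∫⁻ s in Ioi a, ENNReal.ofReal (g s) ≤ ENNReal.ofReal K := by
  have hi : IntegrableOn g (Ioi a) := by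
    refine integrableOn_Ioi_of_intervalIntegral_norm_bounded K a (b := id) (l := atTop)
      (fun i => hg.locallyIntegrable.integrableOn_isCompact isCompact_Icc |>.mono_set
        Ioc_subset_Icc_self) tendsto_id ?_
    filter_upwards [eventually_ge_atTop a] with R hR
    simp only [Real.norm_eq_abs, abs_of_nonneg (h0 _), id]
    exact hK R hR
  rw [← ofReal_integral_eq_lintegral_ofReal hi (Eventually.of_forall h0)]
  refine ENNReal.ofReal_le_ofReal (le_of_tendsto
    (intervalIntegral_tendsto_integral_Ioi a hi tendsto_id) ?_)
  filter_upwards [eventually_ge_atTop a] with R hR using hK R hR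

theorem lintegral_Iic_le_of_intervalIntegral_le {g : ℝ → ℝ} {a K : ℝ} (hg : Continuous g)
    (h0 : ∀ s, 0 ≤ g s) (hK : ∀ R, R ≤ a → ∫ s in R..a, g s ≤ K) :
    ∫⁻ s in Iic a, ENNReal.ofReal (g s) ≤ ENNReal.ofReal K := by
  have hi : IntegrableOn g (Iic a) := by
    refine integrableOn_Iic_of_intervalIntegral_norm_bounded K a (a := id) (l := atBot)
      (fun i => hg.locallyIntegrable.integrableOn_isCompact isCompact_Icc |>.mono_set
        Ioc_subset_Icc_self) tendsto_id ?_
    filter_upwards [eventually_le_atBot a] with R hR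
    simp only [Real.norm_eq_abs, abs_of_nonneg (h0 _), id]
    exact hK R hR
  rw [← ofReal_integral_eq_lintegral_ofReal hi (Eventually.of_forall h0)]
  refine ENNReal.ofReal_le_ofReal (le_of_tendsto
    (intervalIntegral_tendsto_integral_Iic a hi tendsto_id) ?_)
  filter_upwards [eventually_le_atBot a] with R hR using hK R hR

theorem intervalIntegral_le_toReal_lintegral {g : ℝ → ℝ} {S : Set ℝ} {a b : ℝ}
    (hg : Continuous g) (h0 : ∀ s, 0 ≤ g s) (hab : a ≤ b) (hS : Ioc a b ⊆ S)
    (htop : ∫⁻ s in S, ENNReal.ofReal (g s) ≠ ⊤) :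
    ∫ s in a..b, g s ≤ (∫⁻ s in S, ENNReal.ofReal (g s)).toReal := by
  rw [intervalIntegral.integral_of_le hab, integral_eq_lintegral_of_nonneg_ae
    (Eventually.of_forall h0) hg.aestronglyMeasurable]
  exact ENNReal.toReal_mono htop (lintegral_mono_set hS)

theorem isDirichletEV_of_solvesAt {M m E S₀ ω τ B : ℝ} {r φ φ' : ℝ → ℝ} {L : ℕ}
    (hq : Continuous (Vpot M m E r ω L)) (hB : ∀ s, |Vpot M m E r ω L s - τ| ≤ B)
    (hφ : Continuous φ) (hφ' : Continuous φ') (h0 : φ S₀ = 0) (h1 : φ' S₀ = 1)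
    (h : ∀ s, S₀ ≤ s → SolvesAt (fun x => Vpot M m E r ω L x - τ) φ φ' s)
    (hK : ∃ K, ∀ R, S₀ ≤ R → ∫ s in S₀..R, φ s ^ 2 ≤ K)
    (hK' : ∃ K, ∀ R, S₀ ≤ R → ∫ s in S₀..R, φ' s ^ 2 ≤ K) :
    IsDirichletEV M m E r L S₀ (τ - (m ^ 2 - ω ^ 2)) := by
  set Q : ℝ → ℝ := fun x => Vpot M m E r ω L x - τ with hQ
  have hQc : Continuous Q := hq.sub continuous_const
  have hd : ∀ s ∈ Ioi S₀, deriv φ s = φ' s := fun s hs => (h s (le_of_lt hs)).1.deriv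
  have hd' : ∀ s ∈ Ioi S₀, deriv φ' s = Q s * φ s := fun s hs => (h s (le_of_lt hs)).2.deriv
  have hdd : ∀ s ∈ Ioi S₀, deriv (deriv φ) s = Q s * φ s := fun s hs => by
    rw [← hd' s hs]
    refine Filter.EventuallyEq.deriv_eq ?_
    filter_upwards [isOpen_Ioi.mem_nhds hs] with x hx using hd x hx
  obtain ⟨K, hK⟩ := hK
  obtain ⟨K', hK'⟩ := hK'
  have hL2 := lintegral_Ioi_le_of_intervalIntegral_le (hφ.pow 2) (fun s => sq_nonneg _) hK
  have hL2' := lintegral_Ioi_le_of_intervalIntegral_le (hφ'.pow 2) (fun s => sq_nonneg _) hK'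
  refine ⟨φ, ?_, ?_, hL2.trans_lt ENNReal.ofReal_lt_top, ?_, ?_, ?_, ?_⟩
  · by_contra! hz
    have hz' : EqOn φ' (fun _ => 0) (Ioi S₀) := fun s hs => by
      rw [← hd s hs]
      have : φ =ᶠ[nhds s] fun _ => 0 := by
        filter_upwards [isOpen_Ioi.mem_nhds hs] with x hx using hz x hx
      rw [this.deriv_eq]
      simp
    have := hz'.closure hφ' continuous_const (by rw [closure_Ioi]; exact mem_Ici.mpr le_rfl :
      S₀ ∈ closure (Ioi S₀))
    simp only at this
    linarith
  · rw [show (2 : WithTop ℕ∞) = 1 + 1 by norm_num, contDiffOn_succ_iff_deriv_of_isOpen isOpen_Ioi]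
    refine ⟨fun s hs => (h s (le_of_lt hs)).1.differentiableAt.differentiableWithinAt,
      by simp, ?_⟩
    refine ContDiffOn.congr (f := φ') ?_ hd
    rw [show (1 : WithTop ℕ∞) = 0 + 1 by norm_num, contDiffOn_succ_iff_deriv_of_isOpen isOpen_Ioi]
    refine ⟨fun s hs => (h s (le_of_lt hs)).2.differentiableAt.differentiableWithinAt,
      by simp, ?_⟩
    rw [contDiffOn_zero]
    exact (hQc.mul hφ).continuousOn.congr hd'
  · rw [setLIntegral_congr_fun measurableSet_Ioi
      (g := fun s => ENNReal.ofReal (φ' s ^ 2)) fun s hs => by simp only [hd s hs]]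
    exact hL2'.trans_lt ENNReal.ofReal_lt_top
  · rw [setLIntegral_congr_fun measurableSet_Ioi
      (g := fun s => ENNReal.ofReal ((Q s * φ s) ^ 2)) fun s hs => by simp only [hdd s hs]]
    refine lt_of_le_of_lt ?_ (ENNReal.ofReal_lt_top (r := B ^ 2 * K))
    refine lintegral_Ioi_le_of_intervalIntegral_le (by fun_prop) (fun s => sq_nonneg _)
      fun R hR => ?_
    calc ∫ s in S₀..R, (Q s * φ s) ^ 2 ≤ ∫ s in S₀..R, B ^ 2 * φ s ^ 2 := by
          refine intervalIntegral.integral_mono_on hR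
            (Continuous.intervalIntegrable (by fun_prop) _ _)
            (Continuous.intervalIntegrable (by fun_prop) _ _) fun s _ => ?_
          rw [mul_pow]
          have := abs_le.mp (hB s)
          exact mul_le_mul_of_nonneg_right (sq_le_sq' this.1 this.2) (sq_nonneg _)
      _ ≤ B ^ 2 * K := by
          rw [intervalIntegral.integral_const_mul]
          exact mul_le_mul_of_nonneg_left (hK R hR) (sq_nonneg _)
  · have := (hφ.tendsto S₀).mono_left (nhdsWithin_le_nhds (s := Ioi S₀))
    rwa [h0] at this
  · intro s hs
    rw [hdd s hs]
    simp only [hQ, Vpot_eq]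
    ring

/-- The kinetic part of a decaying solution is controlled by its boundary data. -/
theorem integral_sq_deriv_le {q f f' : ℝ → ℝ} {a Bq K k R₁ : ℝ} (hq : Continuous q)
    (hBq : ∀ s, |q s| ≤ Bq) (hk : 0 < k) (haR : a ≤ R₁) (hR₁ : ∀ s, R₁ ≤ s → k ≤ q s)
    (hf : ∀ s, a ≤ s → SolvesAt q f f' s)
    (hlim : Tendsto (fun s => f s * f' s) atTop (nhds 0))
    (hK : ∀ R, a ≤ R → ∫ s in a..R, f s ^ 2 ≤ K) {R : ℝ} (hR : a ≤ R) :
    ∫ s in a..R, f' s ^ 2 ≤ |f a * f' a| + Bq * K := by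
  have hBq0 : 0 ≤ Bq := (abs_nonneg _).trans (hBq a)
  set T := max R R₁ with hT
  have haT : a ≤ T := hR.trans (le_max_left _ _)
  have hcf : ContinuousOn f (Icc a T) := SolvesAt.continuousOn_left fun s hs => hf s hs.1
  have hcf' : ContinuousOn f' (Icc a T) := SolvesAt.continuousOn_right fun s hs => hf s hs.1
  have hff : f T * f' T ≤ 0 := by
    have hm := monotoneOn_mul_of_solvesAt (fun s hs => hf s (haR.trans hs))
      fun s hs => hk.le.trans (hR₁ s hs)
    refine ge_of_tendsto hlim ?_
    filter_upwards [eventually_ge_atTop T] with x hx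
    exact hm (le_max_right R R₁) ((le_max_right R R₁).trans hx) hx
  have i1 : IntervalIntegrable (fun s => f' s ^ 2) volume a T :=
    ContinuousOn.intervalIntegrable (by rw [uIcc_of_le haT]; exact hcf'.pow 2)
  have i2 : IntervalIntegrable (fun s => f s ^ 2) volume a T :=
    ContinuousOn.intervalIntegrable (by rw [uIcc_of_le haT]; exact hcf.pow 2)
  have i3 : IntervalIntegrable (fun s => q s * f s ^ 2) volume a T :=
    ContinuousOn.intervalIntegrable (by
      rw [uIcc_of_le haT]; exact hq.continuousOn.mul (hcf.pow 2))
  have h1 := integral_energy_eq haT hq fun s hs => hf s hs.1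
  rw [intervalIntegral.integral_add i1 i3] at h1
  have h2 : ∫ s in a..T, -(Bq * f s ^ 2) ≤ ∫ s in a..T, q s * f s ^ 2 := by
    refine intervalIntegral.integral_mono_on haT (i2.const_mul Bq).neg i3 fun s _ => ?_
    nlinarith [(abs_le.mp (hBq s)).1, sq_nonneg (f s)]
  rw [intervalIntegral.integral_neg, intervalIntegral.integral_const_mul] at h2
  have h3 : ∫ s in a..R, f' s ^ 2 ≤ ∫ s in a..T, f' s ^ 2 :=
    intervalIntegral.integral_mono_interval le_rfl hR (le_max_left _ _)
      (Eventually.of_forall fun s => sq_nonneg _) i1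
  have h4 := mul_le_mul_of_nonneg_left (hK T haT) hBq0
  linarith [neg_abs_le (f a * f' a)]

theorem exists_weight_bound {δ : ℝ} (hδ : 0 < δ) {S₀ : ℝ} (hS : 0 ≤ S₀) :
    ∃ W : ℝ, 0 ≤ W ∧ ∀ a, a ≤ S₀ → ∫ s in a..S₀, (1 + (max 0 (-s)) ^ (1 + δ))⁻¹ ≤ W := by
  have hp : 0 ≤ 1 + δ := by linarith
  set c := (2 : ℝ) ^ (1 + δ) + (1 + S₀) ^ (1 + δ) with hc
  have hc1 : 0 ≤ (2 : ℝ) ^ (1 + δ) := by positivity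
  have hc2 : 0 ≤ (1 + S₀) ^ (1 + δ) := by positivity
  have hInt : Integrable fun s : ℝ => c * (1 + ‖s‖) ^ (-(1 + δ)) := by
    refine (integrable_one_add_norm (E := ℝ) ?_).const_mul c
    simp only [Module.finrank_self, Nat.cast_one]
    linarith
  have hnn : ∀ s : ℝ, 0 ≤ c * (1 + ‖s‖) ^ (-(1 + δ)) := fun s => by positivity
  have hle : ∀ s, s ≤ S₀ → (1 + (max 0 (-s)) ^ (1 + δ))⁻¹ ≤ c * (1 + ‖s‖) ^ (-(1 + δ)) := by
    intro s hs
    have h0 : 0 ≤ (max 0 (-s)) ^ (1 + δ) := by positivity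
    rw [Real.rpow_neg (by positivity), ← div_eq_mul_inv, inv_eq_one_div,
      div_le_div_iff₀ (by positivity) (by positivity), one_mul, Real.norm_eq_abs]
    rcases le_total 0 s with h | h
    · rw [abs_of_nonneg h]
      have : (1 + s) ^ (1 + δ) ≤ (1 + S₀) ^ (1 + δ) := by gcongr
      nlinarith [mul_nonneg hc1 h0, mul_nonneg hc2 h0]
    · rw [abs_of_nonpos h, max_eq_right (by linarith)]
      rw [max_eq_right (by linarith)] at h0
      rcases le_total (-s) 1 with h1 | h1
      · have : (1 + -s) ^ (1 + δ) ≤ 2 ^ (1 + δ) :=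
          Real.rpow_le_rpow (by linarith) (by linarith) hp
        nlinarith [mul_nonneg hc1 h0, mul_nonneg hc2 h0]
      · have : (1 + -s) ^ (1 + δ) ≤ 2 ^ (1 + δ) * (-s) ^ (1 + δ) := by
          rw [← Real.mul_rpow (by norm_num) (by linarith)]
          exact Real.rpow_le_rpow (by linarith) (by linarith) hp
        nlinarith [mul_nonneg hc1 h0, mul_nonneg hc2 h0]
  refine ⟨∫ s, c * (1 + ‖s‖) ^ (-(1 + δ)), integral_nonneg hnn, fun a ha => ?_⟩
  have hcont : Continuous fun s : ℝ => (1 + (max 0 (-s)) ^ (1 + δ))⁻¹ := by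
    refine Continuous.inv₀ (continuous_const.add ((continuous_const.max continuous_neg).rpow_const
      fun s => Or.inr hp)) fun s => ?_
    have : 0 ≤ (max 0 (-s)) ^ (1 + δ) := by positivity
    positivity
  calc _ ≤ ∫ s in a..S₀, c * (1 + ‖s‖) ^ (-(1 + δ)) :=
        intervalIntegral.integral_mono_on ha (hcont.intervalIntegrable _ _)
          hInt.intervalIntegrable fun s hs => hle s hs.2
    _ = ∫ s in Ioc a S₀, c * (1 + ‖s‖) ^ (-(1 + δ)) := intervalIntegral.integral_of_le ha
    _ ≤ _ := setIntegral_le_integral hInt (Eventually.of_forall hnn)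

theorem HorizonSolution.lintegral_Iic_le {ρ ρ' Q w : ℝ → ℝ} {u v H : ℝ → ℂ}
    {S₀ κ₀ K l ω y m G W : ℝ} (d : HorizonSolution ρ ρ' Q u v H S₀ κ₀ K l ω y)
    (hω : ω ^ 2 ≤ m ^ 2) (hw : Continuous w) (hw0 : ∀ s, 0 ≤ w s) (hw1 : ∀ s, w s ≤ 1)
    (hW : ∀ a, a ≤ S₀ → ∫ s in a..S₀, w s ≤ W)
    (hG : ∀ a s, a ≤ s → s ≤ S₀ →
      ‖v s‖ ^ 2 / ρ s + l ^ 2 * ‖u s‖ ^ 2 + κ₀ / 2 * ∫ t in a..s, ‖v t‖ ^ 2 / ρ t ≤ G) :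
    ∫⁻ s in Iic S₀, ENNReal.ofReal (‖v s‖ ^ 2 / ρ s
      + w s * (‖v s - Complex.I * ω * u s‖ ^ 2 + ‖u s‖ ^ 2)) ≤
      ENNReal.ofReal (G * (6 / κ₀ + (1 + 2 * m ^ 2) * W)) := by
  have hκ := d.rate_pos
  have hA0 : ∀ t, 0 ≤ ‖v t‖ ^ 2 / ρ t := fun t => div_nonneg (sq_nonneg _) (d.weight_pos t).le
  have hAc := d.continuous_div d.continuous_v
  have hl2 : 1 ≤ l ^ 2 := one_le_pow₀ d.one_le
  have hu : ∀ s, s ≤ S₀ → ‖u s‖ ^ 2 ≤ G := fun s hs => by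
    have h1 := hG s s le_rfl hs
    rw [intervalIntegral.integral_same, mul_zero, add_zero] at h1
    nlinarith [hA0 s, sq_nonneg ‖u s‖]
  have hG0 : 0 ≤ G := (sq_nonneg _).trans (hu S₀ le_rfl)
  have hpt : ∀ s ∈ Iic S₀, ENNReal.ofReal (‖v s‖ ^ 2 / ρ s
      + w s * (‖v s - Complex.I * ω * u s‖ ^ 2 + ‖u s‖ ^ 2)) ≤
      ENNReal.ofReal (3 * (‖v s‖ ^ 2 / ρ s) + (1 + 2 * m ^ 2) * G * w s) := by
    intro s hs
    refine ENNReal.ofReal_le_ofReal ?_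
    have h1 : ‖v s - Complex.I * ω * u s‖ ≤ ‖v s‖ + |ω| * ‖u s‖ := by
      refine (norm_sub_le _ _).trans (le_of_eq ?_)
      simp
    have h2 : ‖v s - Complex.I * ω * u s‖ ^ 2 ≤ 2 * ‖v s‖ ^ 2 + 2 * m ^ 2 * ‖u s‖ ^ 2 := by
      calc _ ≤ (‖v s‖ + |ω| * ‖u s‖) ^ 2 := by gcongr
        _ ≤ 2 * (‖v s‖ ^ 2 + (|ω| * ‖u s‖) ^ 2) := add_sq_le
        _ = 2 * ‖v s‖ ^ 2 + 2 * ω ^ 2 * ‖u s‖ ^ 2 := by rw [mul_pow, sq_abs]; ring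
        _ ≤ _ := by gcongr
    have h3 : ‖v s‖ ^ 2 ≤ ‖v s‖ ^ 2 / ρ s := le_div_self (sq_nonneg _) (d.weight_pos s)
      (d.weight_le s)
    have h4 : ‖v s - Complex.I * ω * u s‖ ^ 2 + ‖u s‖ ^ 2 ≤
        2 * (‖v s‖ ^ 2 / ρ s) + (1 + 2 * m ^ 2) * G := by
      nlinarith [hu s hs, mul_le_mul_of_nonneg_left (hu s hs) (sq_nonneg m)]
    have h5 := mul_le_mul_of_nonneg_left h4 (hw0 s)
    have h6 := mul_le_of_le_one_left (hA0 s) (hw1 s)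
    linarith
  refine (setLIntegral_mono' measurableSet_Iic hpt).trans ?_
  refine lintegral_Iic_le_of_intervalIntegral_le (by fun_prop)
    (fun s => by have := hA0 s; have := hw0 s; positivity) fun a ha => ?_
  rw [intervalIntegral.integral_add ((hAc.const_mul 3).intervalIntegrable _ _)
    ((hw.const_mul _).intervalIntegrable _ _), intervalIntegral.integral_const_mul,
    intervalIntegral.integral_const_mul]
  have h7 : ∫ t in a..S₀, ‖v t‖ ^ 2 / ρ t ≤ 2 / κ₀ * G := by
    have h1 := hG a S₀ ha le_rfl
    have h2 : κ₀ / 2 * ∫ t in a..S₀, ‖v t‖ ^ 2 / ρ t ≤ G := by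
      nlinarith [hA0 S₀, sq_nonneg ‖u S₀‖]
    calc _ = 2 / κ₀ * (κ₀ / 2 * ∫ t in a..S₀, ‖v t‖ ^ 2 / ρ t) := by field_simp
      _ ≤ _ := by gcongr
  have h8 := mul_le_mul_of_nonneg_left (hW a ha) (by positivity : 0 ≤ (1 + 2 * m ^ 2) * G)
  calc _ ≤ 3 * (2 / κ₀ * G) + (1 + 2 * m ^ 2) * G * W := by gcongr
    _ = _ := by ring

theorem lintegral_Ioi_energy_le {ρ w : ℝ → ℝ} {u u' : ℝ → ℂ} {a ω m ρ₀ X Y : ℝ}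
    (hu : Continuous u) (hu' : Continuous u') (hω : ω ^ 2 ≤ m ^ 2) (hρ₀ : 0 < ρ₀)
    (hρ : ∀ s, a < s → ρ₀ ≤ ρ s) (hw : ∀ s, a < s → w s = 1)
    (hX : ∀ R, a ≤ R → ∫ s in a..R, ‖u s‖ ^ 2 ≤ X)
    (hY : ∀ R, a ≤ R → ∫ s in a..R, ‖u' s‖ ^ 2 ≤ Y) :
    ∫⁻ s in Ioi a, ENNReal.ofReal (‖u' s + Complex.I * ω * u s‖ ^ 2 / ρ s
      + w s * (‖u' s‖ ^ 2 + ‖u s‖ ^ 2)) ≤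
      ENNReal.ofReal ((2 / ρ₀ + 1) * Y + (2 * m ^ 2 / ρ₀ + 1) * X) := by
  have hpt : ∀ s ∈ Ioi a, ENNReal.ofReal (‖u' s + Complex.I * ω * u s‖ ^ 2 / ρ s
      + w s * (‖u' s‖ ^ 2 + ‖u s‖ ^ 2)) ≤
      ENNReal.ofReal ((2 / ρ₀ + 1) * ‖u' s‖ ^ 2 + (2 * m ^ 2 / ρ₀ + 1) * ‖u s‖ ^ 2) := by
    intro s hs
    refine ENNReal.ofReal_le_ofReal ?_
    have h1 : ‖u' s + Complex.I * ω * u s‖ ≤ ‖u' s‖ + |ω| * ‖u s‖ := by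
      refine (norm_add_le _ _).trans (le_of_eq ?_)
      simp
    have h2 : ‖u' s + Complex.I * ω * u s‖ ^ 2 ≤ 2 * ‖u' s‖ ^ 2 + 2 * m ^ 2 * ‖u s‖ ^ 2 := by
      calc _ ≤ (‖u' s‖ + |ω| * ‖u s‖) ^ 2 := by gcongr
        _ ≤ 2 * (‖u' s‖ ^ 2 + (|ω| * ‖u s‖) ^ 2) := add_sq_le
        _ = 2 * ‖u' s‖ ^ 2 + 2 * ω ^ 2 * ‖u s‖ ^ 2 := by rw [mul_pow, sq_abs]; ring
        _ ≤ _ := by gcongr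
    rw [hw s hs, one_mul]
    have h3 := hρ s hs
    calc _ ≤ (2 * ‖u' s‖ ^ 2 + 2 * m ^ 2 * ‖u s‖ ^ 2) / ρ₀ + (‖u' s‖ ^ 2 + ‖u s‖ ^ 2) := by gcongr
      _ = _ := by ring
  refine (setLIntegral_mono' measurableSet_Ioi hpt).trans ?_
  refine lintegral_Ioi_le_of_intervalIntegral_le (by fun_prop) (fun s => by positivity)
    fun R hR => ?_
  rw [intervalIntegral.integral_add (Continuous.intervalIntegrable (by fun_prop) _ _)
    (Continuous.intervalIntegrable (by fun_prop) _ _), intervalIntegral.integral_const_mul,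
    intervalIntegral.integral_const_mul]
  have := hX R hR
  have := hY R hR
  gcongr

/-- Exterior estimate for complex decaying solutions, together with the vanishing of the flux. -/
theorem exterior_bounds {q : ℝ → ℝ} {u u' : ℝ → ℂ} {a B e k R₁ : ℝ}
    (hq : Continuous q) (hB : ∀ s, |q s| ≤ B)
    (he0 : 0 < e) (he1 : e ≤ 1) (hk : 0 < k) (haR : a ≤ R₁)
    (hR₁ : ∀ τ ∈ Icc (-e) e, ∀ s, R₁ ≤ s → k ≤ q s - τ)
    (hu : ∀ s, a ≤ s → HasDerivAt u (u' s) s) (hu' : ∀ s, a ≤ s → HasDerivAt u' (q s * u s) s)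
    (hcu : Continuous u) (hcu' : Continuous u')
    (hlim : Tendsto (fun s => ‖u s‖ * ‖u' s‖) atTop (nhds 0))
    (hno : ∀ τ ∈ Icc (-e) e, ∀ φ φ' : ℝ → ℝ, Continuous φ → Continuous φ' → φ a = 0 → φ' a = 1 →
      (∀ s, a ≤ s → SolvesAt (fun x => q x - τ) φ φ' s) →
      (∃ K, ∀ R, a ≤ R → ∫ s in a..R, φ s ^ 2 ≤ K) →
      (∃ K, ∀ R, a ≤ R → ∫ s in a..R, φ' s ^ 2 ≤ K) → False) :
    (∀ R, a ≤ R → ∫ s in a..R, ‖u s‖ ^ 2 ≤ (2 * (B + 7) / e) ^ 2 * ‖u a‖ ^ 2) ∧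
    (∀ R, a ≤ R → ∫ s in a..R, ‖u' s‖ ^ 2 ≤
      2 * (‖u a‖ * ‖u' a‖) + B * ((2 * (B + 7) / e) ^ 2 * ‖u a‖ ^ 2)) ∧
    (starRingEnd ℂ (u a) * u' a).im = 0 := by
  have h0e : (0 : ℝ) ∈ Icc (-e) e := ⟨by linarith, he0.le⟩
  have hR₁' : ∀ s, R₁ ≤ s → k ≤ q s := fun s hs => by simpa using hR₁ 0 h0e s hs
  have hre : ∀ s, a ≤ s → SolvesAt q (fun s => (u s).re) (fun s => (u' s).re) s := fun s hs =>
    ⟨Complex.reCLM.hasFDerivAt.comp_hasDerivAt s (hu s hs), by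
      refine (Complex.reCLM.hasFDerivAt.comp_hasDerivAt s (hu' s hs)).congr_deriv ?_
      simp⟩
  have him : ∀ s, a ≤ s → SolvesAt q (fun s => (u s).im) (fun s => (u' s).im) s := fun s hs =>
    ⟨Complex.imCLM.hasFDerivAt.comp_hasDerivAt s (hu s hs), by
      refine (Complex.imCLM.hasFDerivAt.comp_hasDerivAt s (hu' s hs)).congr_deriv ?_
      simp⟩
  have hlre : Tendsto (fun s => (u s).re * (u' s).re) atTop (nhds 0) :=
    squeeze_zero_norm (fun s => by
      rw [norm_mul]
      exact mul_le_mul (Complex.abs_re_le_norm _) (Complex.abs_re_le_norm _) (norm_nonneg _)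
        (norm_nonneg _)) hlim
  have hlim' : Tendsto (fun s => (u s).im * (u' s).im) atTop (nhds 0) :=
    squeeze_zero_norm (fun s => by
      rw [norm_mul]
      exact mul_le_mul (Complex.abs_im_le_norm _) (Complex.abs_im_le_norm _) (norm_nonneg _)
        (norm_nonneg _)) hlim
  have hn : ∀ z : ℂ, ‖z‖ ^ 2 = z.re ^ 2 + z.im ^ 2 := fun z => by
    rw [← Complex.normSq_eq_norm_sq, Complex.normSq_apply]
    ring
  have b1 : ∀ R, a ≤ R → _ := fun R hR => integral_sq_le_of_no_dirichlet hq hB (fun s _ => hB s)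
    he0 he1 hk haR hR₁ hre hlre hno hR
  have b2 : ∀ R, a ≤ R → _ := fun R hR => integral_sq_le_of_no_dirichlet hq hB (fun s _ => hB s)
    he0 he1 hk haR hR₁ him hlim' hno hR
  have hsplit : ∀ w : ℝ → ℂ, Continuous w → ∀ R, ∫ s in a..R, ‖w s‖ ^ 2 =
      (∫ s in a..R, (w s).re ^ 2) + ∫ s in a..R, (w s).im ^ 2 := fun w hw R => by
    simp_rw [hn]
    exact intervalIntegral.integral_add (Continuous.intervalIntegrable (by fun_prop) _ _)
      (Continuous.intervalIntegrable (by fun_prop) _ _)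
  refine ⟨fun R hR => ?_, fun R hR => ?_, ?_⟩
  · rw [hsplit u hcu, hn (u a)]
    linarith [b1 R hR, b2 R hR]
  · have c1 := integral_sq_deriv_le hq hB hk haR hR₁' hre hlre b1 hR
    have c2 := integral_sq_deriv_le hq hB hk haR hR₁' him hlim' b2 hR
    have d1 : |(u a).re * (u' a).re| ≤ ‖u a‖ * ‖u' a‖ := by
      rw [abs_mul]
      exact mul_le_mul (Complex.abs_re_le_norm _) (Complex.abs_re_le_norm _) (abs_nonneg _)
        (norm_nonneg _)
    have d2 : |(u a).im * (u' a).im| ≤ ‖u a‖ * ‖u' a‖ := by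
      rw [abs_mul]
      exact mul_le_mul (Complex.abs_im_le_norm _) (Complex.abs_im_le_norm _) (abs_nonneg _)
        (norm_nonneg _)
    rw [hsplit u' hcu', hn (u a)]
    linarith
  · have hl : Tendsto (fun s => (starRingEnd ℂ (u s) * u' s).im) atTop (nhds 0) :=
      squeeze_zero_norm (fun s => by
        rw [Real.norm_eq_abs]
        refine (Complex.abs_im_le_norm _).trans (le_of_eq ?_)
        rw [norm_mul, RCLike.norm_conj]) hlim
    refine tendsto_nhds_unique (f := fun s => (starRingEnd ℂ (u s) * u' s).im) (l := atTop) ?_ hl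
    refine tendsto_const_nhds.congr' ?_
    filter_upwards [eventually_ge_atTop a] with s hs
    have := wronskian_eq hre him hs
    simp only [Complex.mul_im, Complex.conj_re, Complex.conj_im]
    linarith

/-- The explicit constants combine into a single exponential factor. -/
theorem combine_constants {κ₀ c m ω L N y G W ρ₀ Kq EE b b' : ℝ} (hκ : 0 < κ₀) (hc : 0 ≤ c)
    (hm : 0 < m) (hL : 1 ≤ L) (hN : 0 ≤ N) (hW : 0 ≤ W) (hρ : 0 < ρ₀) (hKq : 0 ≤ Kq)
    (hE0 : 0 < EE) (hE1 : EE ≤ 1) (hω : m ^ 2 / 4 ≤ ω ^ 2)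
    (hy : y ≤ (4 / κ₀ + 2 * (Real.exp (c * L) / κ₀) / ω ^ 2) * N)
    (hG : G = Real.exp (c * L) * (L ^ 2 * y + 4 / κ₀ * N))
    (hb : b ^ 2 ≤ G) (hb' : b' ^ 2 ≤ (2 + 2 * m ^ 2) * G) :
    G * (6 / κ₀ + (1 + 2 * m ^ 2) * W) +
      ((2 / ρ₀ + 1) * (2 * (b * b') +
          Kq * L ^ 2 * ((2 * (Kq * L ^ 2 + 7) / (EE / 2)) ^ 2 * b ^ 2)) +
        (2 * m ^ 2 / ρ₀ + 1) * ((2 * (Kq * L ^ 2 + 7) / (EE / 2)) ^ 2 * b ^ 2)) ≤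
    (16 * (Kq + 7) ^ 2 * (8 / κ₀ + 8 / (κ₀ * m ^ 2)) *
      ((6 / κ₀ + (1 + 2 * m ^ 2) * W) +
        ((2 / ρ₀ + 1) * (3 + 2 * m ^ 2 + Kq) + (2 * m ^ 2 / ρ₀ + 1)))) * EE⁻¹ ^ 2 *
      Real.exp ((2 * c + 8) * L) * N := by
  set c₁ := 6 / κ₀ + (1 + 2 * m ^ 2) * W with hc₁
  set x := 2 / ρ₀ + 1 with hx
  set z := 2 * m ^ 2 / ρ₀ + 1 with hz
  set T := (2 * (Kq * L ^ 2 + 7) / (EE / 2)) ^ 2 with hT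
  have hL2 : 1 ≤ L ^ 2 := one_le_pow₀ hL
  have hG0 : 0 ≤ G := (sq_nonneg _).trans hb
  have hx0 : 0 ≤ x := by positivity
  have hz0 : 0 ≤ z := by positivity
  have hc0 : 0 ≤ c₁ := by positivity
  have hT1 : 1 ≤ T := by
    refine one_le_pow₀ ?_
    rw [le_div_iff₀ (by positivity)]
    nlinarith [mul_nonneg hKq (sq_nonneg L)]
  have hTle : T ≤ 16 * (Kq + 7) ^ 2 * L ^ 4 * EE⁻¹ ^ 2 := by
    have h1 : Kq * L ^ 2 + 7 ≤ (Kq + 7) * L ^ 2 := by nlinarith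
    have h2 : T = 16 * (Kq * L ^ 2 + 7) ^ 2 * EE⁻¹ ^ 2 := by
      rw [hT]; field_simp; ring
    rw [h2]
    calc _ ≤ 16 * ((Kq + 7) * L ^ 2) ^ 2 * EE⁻¹ ^ 2 := by gcongr
      _ = _ := by ring
  have hTL : 1 ≤ T * L ^ 2 := one_le_mul_of_one_le_of_one_le hT1 hL2
  have hGT : G ≤ G * (T * L ^ 2) := le_mul_of_one_le_right hG0 hTL
  have hbb : 2 * (b * b') ≤ (3 + 2 * m ^ 2) * G := by nlinarith [sq_nonneg (b - b')]
  have hTb : T * b ^ 2 ≤ G * T := by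
    rw [mul_comm]; gcongr
  have s1 : G * c₁ ≤ G * (T * L ^ 2) * c₁ := by gcongr
  have s2 : 2 * (b * b') + Kq * L ^ 2 * (T * b ^ 2) ≤
      G * (T * L ^ 2) * (3 + 2 * m ^ 2 + Kq) := by
    have e1 : (3 + 2 * m ^ 2) * G ≤ (3 + 2 * m ^ 2) * (G * (T * L ^ 2)) := by gcongr
    have e2 : Kq * L ^ 2 * (T * b ^ 2) ≤ Kq * L ^ 2 * (G * T) := by gcongr
    linarith
  have s3 : T * b ^ 2 ≤ G * (T * L ^ 2) := by
    refine hTb.trans ?_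
    rw [← mul_assoc]
    exact le_mul_of_one_le_right (by positivity) hL2
  have s4 : G * c₁ + (x * (2 * (b * b') + Kq * L ^ 2 * (T * b ^ 2)) + z * (T * b ^ 2)) ≤
      G * (T * L ^ 2) * (c₁ + (x * (3 + 2 * m ^ 2 + Kq) + z)) := by
    have e1 := mul_le_mul_of_nonneg_left s2 hx0
    have e2 := mul_le_mul_of_nonneg_left s3 hz0
    linarith
  have hexp1 : 1 ≤ Real.exp (c * L) := Real.one_le_exp (by positivity)
  have hGle : G ≤ (8 / κ₀ + 8 / (κ₀ * m ^ 2)) * L ^ 2 * Real.exp (c * L) ^ 2 * N := by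
    have hω0 : 0 < ω ^ 2 := lt_of_lt_of_le (by positivity) hω
    have e1 : 2 * (Real.exp (c * L) / κ₀) / ω ^ 2 ≤ 8 / (κ₀ * m ^ 2) * Real.exp (c * L) := by
      calc _ ≤ 2 * (Real.exp (c * L) / κ₀) / (m ^ 2 / 4) := by gcongr
        _ = _ := by field_simp; norm_num
    have e2 : y ≤ (4 / κ₀ + 8 / (κ₀ * m ^ 2)) * Real.exp (c * L) * N := by
      refine hy.trans (mul_le_mul_of_nonneg_right ?_ hN)
      have : 4 / κ₀ ≤ 4 / κ₀ * Real.exp (c * L) := le_mul_of_one_le_right (by positivity) hexp1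
      linarith
    have e3 : 4 / κ₀ * N ≤ L ^ 2 * (4 / κ₀ * Real.exp (c * L) * N) := by
      have h1 : 4 / κ₀ * N ≤ 4 / κ₀ * N * (L ^ 2 * Real.exp (c * L)) :=
        le_mul_of_one_le_right (by positivity) (one_le_mul_of_one_le_of_one_le hL2 hexp1)
      linarith
    have e4 : L ^ 2 * y + 4 / κ₀ * N ≤
        L ^ 2 * ((8 / κ₀ + 8 / (κ₀ * m ^ 2)) * Real.exp (c * L) * N) := by
      have := mul_le_mul_of_nonneg_left e2 (sq_nonneg L)
      have e5 : (8 : ℝ) / κ₀ = 4 / κ₀ + 4 / κ₀ := by ring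
      rw [e5]
      linarith
    rw [hG]
    calc _ ≤ Real.exp (c * L) * (L ^ 2 * ((8 / κ₀ + 8 / (κ₀ * m ^ 2)) * Real.exp (c * L) * N)) := by
          gcongr
      _ = _ := by ring
  have hpoly : L ^ 8 * Real.exp (c * L) ^ 2 ≤ Real.exp ((2 * c + 8) * L) := by
    have h1 : L ≤ Real.exp L := by linarith [Real.add_one_le_exp L]
    calc L ^ 8 * Real.exp (c * L) ^ 2 ≤ Real.exp L ^ 8 * Real.exp (c * L) ^ 2 := by gcongr
      _ = Real.exp ((2 * c + 8) * L) := by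
        rw [← Real.exp_nat_mul, ← Real.exp_nat_mul, ← Real.exp_add]
        congr 1
        push_cast
        ring
  set c₂ := 8 / κ₀ + 8 / (κ₀ * m ^ 2) with hc₂
  set c₃ := c₁ + (x * (3 + 2 * m ^ 2 + Kq) + z) with hc₃
  have hc₂0 : 0 ≤ c₂ := by positivity
  have hc₃0 : 0 ≤ c₃ := by positivity
  refine s4.trans ?_
  calc G * (T * L ^ 2) * c₃ ≤ (c₂ * L ^ 2 * Real.exp (c * L) ^ 2 * N) *
        ((16 * (Kq + 7) ^ 2 * L ^ 4 * EE⁻¹ ^ 2) * L ^ 2) * c₃ := by gcongr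
    _ = (16 * (Kq + 7) ^ 2 * c₂ * c₃) * EE⁻¹ ^ 2 * N * (L ^ 8 * Real.exp (c * L) ^ 2) := by ring
    _ ≤ (16 * (Kq + 7) ^ 2 * c₂ * c₃) * EE⁻¹ ^ 2 * N * Real.exp ((2 * c + 8) * L) := by gcongr
    _ = _ := by ring

theorem exp_neg_mul_log_le {p L : ℕ} (hL : 1 ≤ L) (hp : 2 * p ≤ L) :
    Real.exp (-(1 / 2) * Real.sqrt ((L : ℝ) * ((L : ℝ) + 1)) *
      Real.log (Real.sqrt ((L : ℝ) * ((L : ℝ) + 1)))) ≤ ((L : ℝ) ^ p)⁻¹ := by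
  have hL1 : (1 : ℝ) ≤ L := by exact_mod_cast hL
  have hp' : 2 * (p : ℝ) ≤ L := by exact_mod_cast hp
  have hs : (L : ℝ) ≤ Real.sqrt ((L : ℝ) * ((L : ℝ) + 1)) := Real.le_sqrt_of_sq_le (by nlinarith)
  set s := Real.sqrt ((L : ℝ) * ((L : ℝ) + 1))
  have hlog : Real.log L ≤ Real.log s := Real.log_le_log (by linarith) hs
  have hlog0 : 0 ≤ Real.log (L : ℝ) := Real.log_nonneg hL1
  have h1 : 2 * (p : ℝ) * Real.log L ≤ s * Real.log s :=
    mul_le_mul (hp'.trans hs) hlog hlog0 (by linarith)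
  have h2 : ((L : ℝ) ^ p)⁻¹ = Real.exp (-(p * Real.log L)) := by
    rw [Real.exp_neg, mul_comm, Real.exp_mul, Real.exp_log (by linarith), Real.rpow_natCast]
  rw [h2]
  exact Real.exp_le_exp.mpr (by linarith)

theorem WeaklyOutgoing.exists_amplitude {ω : ℝ} {u : ℝ → ℂ} (h : WeaklyOutgoing ω u) :
    ∃ y : ℝ, Tendsto (fun s => ‖u s‖ ^ 2) atBot (nhds y) ∧
      Tendsto (fun s => deriv u s + Complex.I * ω * u s) atBot (nhds 0) := by
  obtain ⟨⟨c, h1, h2⟩, -⟩ := h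
  refine ⟨‖c‖ ^ 2, Tendsto.pow ?_ 2, ?_⟩
  · have hn : ∀ s : ℝ, ‖c * Complex.exp (-Complex.I * ω * s)‖ = ‖c‖ := fun s => by
      rw [norm_mul, show -Complex.I * (ω : ℂ) * (s : ℂ) = ((-(ω * s) : ℝ) : ℂ) * Complex.I by
        push_cast; ring, Complex.norm_exp_ofReal_mul_I, mul_one]
    rw [tendsto_iff_norm_sub_tendsto_zero]
    refine squeeze_zero (fun s => norm_nonneg _) (fun s => ?_)
      (tendsto_zero_iff_norm_tendsto_zero.mp h1)
    rw [Real.norm_eq_abs, ← hn s]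
    exact abs_norm_sub_norm_le _ _
  · have h3 := h2.add (h1.const_mul (Complex.I * ω))
    simp only [mul_zero, add_zero] at h3
    refine h3.congr fun s => ?_
    ring

theorem WeaklyOutgoing.tendsto_mul {ω : ℝ} {u : ℝ → ℂ} (h : WeaklyOutgoing ω u) :
    Tendsto (fun s => ‖u s‖ * ‖deriv u s‖) atTop (nhds 0) := by
  obtain ⟨-, ε, hε, h⟩ := h
  have h2 := h.mul h
  rw [mul_zero] at h2
  refine squeeze_zero' (Eventually.of_forall fun s => by positivity) ?_ h2
  filter_upwards [eventually_ge_atTop 0] with s hs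
  have h1 : 1 ≤ Real.exp (ε * s) := Real.one_le_exp (by positivity)
  have ha := norm_nonneg (u s)
  have hb := norm_nonneg (deriv u s)
  have h3 : ‖u s‖ + ‖deriv u s‖ ≤ Real.exp (ε * s) * (‖u s‖ + ‖deriv u s‖) :=
    le_mul_of_one_le_left (by positivity) h1
  exact mul_le_mul (by linarith) (by linarith) hb (by positivity)

/-- A real shift smaller than the distance to the Dirichlet spectrum is not an eigenvalue. -/
theorem not_isDirichletEV_of_abs_lt {M m E S₀ g τ EE : ℝ} {r : ℝ → ℝ} {L : ℕ}
    (hEE : EE = sInf {x : ℝ | ∃ lam : ℝ, lam ≤ 0 ∧ IsDirichletEV M m E r L S₀ lam ∧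
      x = |g + lam|}) (hτ : |τ| < EE) (hg : EE ≤ g) : ¬ IsDirichletEV M m E r L S₀ (τ - g) := by
  intro hev
  have h1 : EE ≤ |g + (τ - g)| := by
    rw [hEE]
    refine csInf_le ⟨0, ?_⟩ ⟨τ - g, ?_, hev, rfl⟩
    · rintro x ⟨lam, -, -, rfl⟩
      exact abs_nonneg _
    · linarith [le_abs_self τ]
  rw [add_sub_cancel] at h1
  linarith

theorem eq_zero_of_eqOn_Ioi {H : ℝ → ℂ} (hH : Continuous H) {a : ℝ} (h : ∀ s, a < s → H s = 0)
    {s : ℝ} (hs : a ≤ s) : H s = 0 := by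
  have h1 : closure (Ioi a) ⊆ H ⁻¹' {0} :=
    closure_minimal (fun x hx => h x hx) (isClosed_singleton.preimage hH)
  rw [closure_Ioi] at h1
  exact h1 hs

theorem horizonSolution_of_weaklyOutgoing {M m E ω S₀ κ₀ K rp y : ℝ} {r ρ' : ℝ → ℝ} {L : ℕ}
    {u H : ℝ → ℂ} (hrp : 0 < rp) (hr : Continuous r) (hr1 : ∀ s, rp < r s) (hL : 1 ≤ L)
    (hκ₀ : 0 < κ₀) (hK : 0 ≤ K)
    (hρ' : ∀ s, HasDerivAt (fun x => (r x - rp) / r x) (ρ' s) s)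
    (hρ : ∀ s, s ≤ S₀ → κ₀ * ((r s - rp) / r s) ≤ ρ' s)
    (hQ : ∀ s, |W0 M m E r L s + m ^ 2| ≤ K * (L : ℝ) ^ 2 * ((r s - rp) / r s))
    (hH : Continuous H) (hu : ContDiff ℝ 2 u)
    (heq : ∀ s : ℝ, deriv (deriv u) s - (Vpot M m E r ω L s : ℂ) * u s = H s)
    (hv : Tendsto (fun s => deriv u s + Complex.I * ω * u s) atBot (nhds 0))
    (hy : Tendsto (fun s => ‖u s‖ ^ 2) atBot (nhds y)) :
    HorizonSolution (fun s => (r s - rp) / r s) ρ' (fun s => W0 M m E r L s + m ^ 2) u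
      (fun s => deriv u s + Complex.I * ω * u s) H S₀ κ₀ K L ω y := by
  have hpos : ∀ s, 0 < r s := fun s => hrp.trans (hr1 s)
  have hd : ∀ s, HasDerivAt u (deriv u s) s := fun s =>
    (hu.differentiable (by norm_num) s).hasDerivAt
  have hu2 : ContDiff ℝ 1 (deriv u) := hu.iterate_deriv' 1 1
  have hd' : ∀ s, HasDerivAt (deriv u) (deriv (deriv u) s) s := fun s =>
    (hu2.differentiable (by norm_num) s).hasDerivAt
  refine ⟨hκ₀, hK, by exact_mod_cast hL, fun s => div_pos (sub_pos.mpr (hr1 s)) (hpos s),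
    fun s => ?_, hρ', hρ, (continuous_W0 hrp hr hr1 L).add continuous_const, hQ, hH,
    fun s => ?_, fun s => ?_, hv, hy⟩
  · rw [div_le_one (hpos s)]
    linarith
  · exact (hd s).congr_deriv (by ring)
  · refine ((hd' s).add ((hd s).const_mul (Complex.I * (ω : ℂ)))).congr_deriv ?_
    have h := heq s
    rw [Vpot_eq] at h
    push_cast at h ⊢
    linear_combination h - (ω : ℂ) ^ 2 * u s * Complex.I_sq

theorem setLIntegral_const_mul_add_le {f : ℝ → ℝ} {a x y z J : ℝ} {j : ENNReal}
    (h1 : ∫⁻ s in Iic a, ENNReal.ofReal (f s) ≤ ENNReal.ofReal x)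
    (h2 : ∫⁻ s in Ioi a, ENNReal.ofReal (f s) ≤ ENNReal.ofReal y)
    (hx : 0 ≤ x) (hy : 0 ≤ y) (hz : 0 ≤ z) (hj : ENNReal.ofReal J = j)
    (h : x + y ≤ z * J) : ∫⁻ s, ENNReal.ofReal (f s) ≤ ENNReal.ofReal z * j := by
  rw [← lintegral_add_compl _ (measurableSet_Iic (a := a)), compl_Iic, ← hj,
    ← ENNReal.ofReal_mul hz]
  calc _ ≤ ENNReal.ofReal x + ENNReal.ofReal y := add_le_add h1 h2
    _ = ENNReal.ofReal (x + y) := (ENNReal.ofReal_add hx hy).symm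
    _ ≤ _ := ENNReal.ofReal_le_ofReal h

theorem exterior_estimate {M m E rp S₀ ω EE Kq : ℝ} {r : ℝ → ℝ} {L : ℕ} {u H : ℝ → ℂ}
    (hrp : 0 < rp) (hr : Continuous r) (hr1 : ∀ s, rp < r s) (hrt : Tendsto r atTop atTop)
    (hq : ∀ s, |Vpot M m E r ω L s| ≤ Kq * (L : ℝ) ^ 2)
    (hEE : EE = sInf {x : ℝ | ∃ lam : ℝ, lam ≤ 0 ∧ IsDirichletEV M m E r L S₀ lam ∧
      x = |m ^ 2 - ω ^ 2 + lam|})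
    (hE0 : 0 < EE) (hE1 : EE ≤ 1) (hg : EE ≤ m ^ 2 - ω ^ 2)
    (hH : Continuous H) (hu : ContDiff ℝ 2 u)
    (heq : ∀ s : ℝ, deriv (deriv u) s - (Vpot M m E r ω L s : ℂ) * u s = H s)
    (hout : WeaklyOutgoing ω u) (hH0 : ∀ s, S₀ < s → H s = 0) :
    (∀ R, S₀ ≤ R → ∫ s in S₀..R, ‖u s‖ ^ 2 ≤
      (2 * (Kq * (L : ℝ) ^ 2 + 7) / (EE / 2)) ^ 2 * ‖u S₀‖ ^ 2) ∧
    (∀ R, S₀ ≤ R → ∫ s in S₀..R, ‖deriv u s‖ ^ 2 ≤ 2 * (‖u S₀‖ * ‖deriv u S₀‖) +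
      Kq * (L : ℝ) ^ 2 * ((2 * (Kq * (L : ℝ) ^ 2 + 7) / (EE / 2)) ^ 2 * ‖u S₀‖ ^ 2)) ∧
    (starRingEnd ℂ (u S₀) * deriv u S₀).im = 0 := by
  have hqc : Continuous (Vpot M m E r ω L) := by
    rw [funext (Vpot_eq M m E r ω L)]
    exact (continuous_W0 hrp hr hr1 L).add continuous_const
  have hu2 : ContDiff ℝ 1 (deriv u) := hu.iterate_deriv' 1 1
  obtain ⟨R, hR⟩ := eventually_atTop.mp ((tendsto_W0 (M := M) (m := m) (E := E) hrt L).eventually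
    (eventually_ge_nhds (show -((m ^ 2 - ω ^ 2) / 4) < 0 by linarith)))
  refine exterior_bounds (R₁ := max S₀ R) (k := (m ^ 2 - ω ^ 2) / 4) hqc hq (by linarith)
    (by linarith) (by linarith) (le_max_left _ _) (fun τ hτ s hs => ?_)
    (fun s _ => (hu.differentiable (by norm_num) s).hasDerivAt) (fun s hs => ?_)
    hu.continuous hu2.continuous hout.tendsto_mul ?_
  · rw [Vpot_eq]
    linarith [hR s ((le_max_right _ _).trans hs), hτ.2]
  · refine (hu2.differentiable (by norm_num) s).hasDerivAt.congr_deriv ?_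
    have h := heq s
    rw [eq_zero_of_eqOn_Ioi hH hH0 hs] at h
    exact sub_eq_zero.mp h
  · intro τ hτ φ φ' hφ hφ' h0 h1 hs hK hK'
    have hτ' : |τ| ≤ EE / 2 := abs_le.mpr hτ
    refine not_isDirichletEV_of_abs_lt hEE (hτ'.trans_lt (by linarith)) hg
      (isDirichletEV_of_solvesAt (B := Kq * (L : ℝ) ^ 2 + 1) hqc (fun s => ?_) hφ hφ' h0 h1 hs
        hK hK')
    exact (abs_sub _ _).trans (add_le_add (hq s) (by linarith))

theorem norm_sub_mul_sq_le {a b : ℂ} {ω m G : ℝ} (hω : 0 < ω) (hωm : ω ^ 2 ≤ m ^ 2)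
    (ha : ‖a‖ ^ 2 ≤ G) (hb : ‖b‖ ^ 2 ≤ G) : ‖a - Complex.I * ω * b‖ ^ 2 ≤ (2 + 2 * m ^ 2) * G := by
  have h1 : ‖a - Complex.I * ω * b‖ ≤ ‖a‖ + ω * ‖b‖ := by
    refine (norm_sub_le _ _).trans_eq ?_
    simp [abs_of_pos hω]
  have h2 : ω ^ 2 * ‖b‖ ^ 2 ≤ m ^ 2 * G := mul_le_mul hωm hb (sq_nonneg _) (sq_nonneg _)
  calc ‖a - Complex.I * ω * b‖ ^ 2 ≤ (‖a‖ + ω * ‖b‖) ^ 2 := pow_le_pow_left₀ (norm_nonneg _) h1 2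
    _ ≤ 2 * (‖a‖ ^ 2 + (ω * ‖b‖) ^ 2) := add_sq_le
    _ = 2 * ‖a‖ ^ 2 + 2 * (ω ^ 2 * ‖b‖ ^ 2) := by ring
    _ ≤ _ := by linarith

set_option maxHeartbeats 1000000 in
theorem energy_estimate {M m E rp S₀ ω κ₀ K Kq W EE : ℝ} {r ρ' w : ℝ → ℝ} {L : ℕ}
    {u H : ℝ → ℂ} (hrp : 0 < rp) (hr : Continuous r) (hr1 : ∀ s, rp < r s)
    (hmono : ∀ s t, s ≤ t → r s ≤ r t) (hrt : Tendsto r atTop atTop)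
    (hm : 0 < m) (hL : 1 ≤ L) (hκ₀ : 0 < κ₀) (hK : 0 ≤ K)
    (hρ' : ∀ s, HasDerivAt (fun x => (r x - rp) / r x) (ρ' s) s)
    (hρ : ∀ s, s ≤ S₀ → κ₀ * ((r s - rp) / r s) ≤ ρ' s)
    (hQ : ∀ s, |W0 M m E r L s + m ^ 2| ≤ K * (L : ℝ) ^ 2 * ((r s - rp) / r s))
    (hKq : 0 ≤ Kq) (hq : ∀ s, |Vpot M m E r ω L s| ≤ Kq * (L : ℝ) ^ 2)
    (hw : Continuous w) (hw0 : ∀ s, 0 ≤ w s) (hw1 : ∀ s, w s ≤ 1) (hw2 : ∀ s, S₀ < s → w s = 1)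
    (hW0 : 0 ≤ W) (hW : ∀ a, a ≤ S₀ → ∫ s in a..S₀, w s ≤ W)
    (hω0 : 0 < ω) (hω1 : m ^ 2 / 4 ≤ ω ^ 2)
    (hEE : EE = sInf {x : ℝ | ∃ lam : ℝ, lam ≤ 0 ∧ IsDirichletEV M m E r L S₀ lam ∧
      x = |m ^ 2 - ω ^ 2 + lam|})
    (hE0 : 0 < EE) (hE1 : EE ≤ 1) (hg : EE ≤ m ^ 2 - ω ^ 2)
    (hH : Continuous H) (hu : ContDiff ℝ 2 u)
    (heq : ∀ s : ℝ, deriv (deriv u) s - (Vpot M m E r ω L s : ℂ) * u s = H s)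
    (hout : WeaklyOutgoing ω u) (hH0 : ∀ s, S₀ < s → H s = 0) :
    ∫⁻ s : ℝ, ENNReal.ofReal (r s / (r s - rp) * ‖deriv u s + Complex.I * ω * u s‖ ^ 2
        + w s * (‖deriv u s‖ ^ 2 + ‖u s‖ ^ 2)) ≤
      ENNReal.ofReal ((16 * (Kq + 7) ^ 2 * (8 / κ₀ + 8 / (κ₀ * m ^ 2)) *
      ((6 / κ₀ + (1 + 2 * m ^ 2) * W) + ((2 / ((r S₀ - rp) / r S₀) + 1) * (3 + 2 * m ^ 2 + Kq) +
        (2 * m ^ 2 / ((r S₀ - rp) / r S₀) + 1)))) * EE⁻¹ ^ 2 *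
        Real.exp ((2 * (2 * (K + 1) / κ₀) + 8) * L)) *
      ∫⁻ s in Iic S₀, ENNReal.ofReal (r s / (r s - rp) * ‖H s‖ ^ 2) := by
  have hpos : ∀ s, 0 < r s := fun s => hrp.trans (hr1 s)
  have hsub : ∀ s, 0 < r s - rp := fun s => sub_pos.mpr (hr1 s)
  have hdiv : ∀ s x, r s / (r s - rp) * x = x / ((r s - rp) / r s) := fun s x => by
    have := hpos s
    have := hsub s
    field_simp
  simp only [hdiv]
  obtain ⟨y, hy, hv⟩ := hout.exists_amplitude
  have d := horizonSolution_of_weaklyOutgoing hrp hr hr1 hL hκ₀ hK hρ' hρ hQ hH hu heq hv hy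
  have hρ₀ := d.weight_pos S₀
  set ρ : ℝ → ℝ := fun s => (r s - rp) / r s with hρdef
  set v : ℝ → ℂ := fun s => deriv u s + Complex.I * ω * u s with hvdef
  have hvu : ∀ s, v s - Complex.I * ω * u s = deriv u s := fun s => by simp [hvdef]
  have hωm : ω ^ 2 ≤ m ^ 2 := by linarith
  obtain ⟨hX, hY, hflux⟩ := exterior_estimate hrp hr hr1 hrt hq hEE hE0 hE1 hg hH hu heq hout hH0
  set C := 16 * (Kq + 7) ^ 2 * (8 / κ₀ + 8 / (κ₀ * m ^ 2)) *
      ((6 / κ₀ + (1 + 2 * m ^ 2) * W) + ((2 / ρ S₀ + 1) * (3 + 2 * m ^ 2 + Kq) +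
        (2 * m ^ 2 / ρ S₀ + 1))) with hC
  have hC0 : 0 < C := by positivity
  have hz : 0 < C * EE⁻¹ ^ 2 * Real.exp ((2 * (2 * (K + 1) / κ₀) + 8) * L) := by positivity
  set J := ∫⁻ s in Iic S₀, ENNReal.ofReal (‖H s‖ ^ 2 / ρ s) with hJ
  rcases eq_or_ne J ⊤ with htop | htop
  · refine le_top.trans_eq ?_
    change ⊤ = _ * J
    rw [htop, ENNReal.mul_top (by simpa using hz)]
  have hN0 : 0 ≤ J.toReal := ENNReal.toReal_nonneg
  have hN : ∀ a b, a ≤ b → b ≤ S₀ → ∫ s in a..b, ‖H s‖ ^ 2 / ρ s ≤ J.toReal :=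
    fun a b hab hb => intervalIntegral_le_toReal_lintegral (d.continuous_div d.source_cont)
      (fun s => div_nonneg (sq_nonneg _) (d.weight_pos s).le) hab
      (fun x hx => hx.2.trans hb) htop
  have hyb := d.amplitude_le hω0 hN0 hN (by rw [hvu]; exact hflux)
  set G := Real.exp (2 * (K + 1) / κ₀ * L) * ((L : ℝ) ^ 2 * y + 4 / κ₀ * J.toReal) with hG
  have hen : ∀ a s, a ≤ s → s ≤ S₀ → ‖v s‖ ^ 2 / ρ s + (L : ℝ) ^ 2 * ‖u s‖ ^ 2 +
      κ₀ / 2 * ∫ t in a..s, ‖v t‖ ^ 2 / ρ t ≤ G :=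
    fun a s has hs => d.energy_le_of_limit hN0 hN has hs
  have hS := hen S₀ S₀ le_rfl le_rfl
  rw [intervalIntegral.integral_same, mul_zero, add_zero] at hS
  have hL2 : (1 : ℝ) ≤ (L : ℝ) ^ 2 := one_le_pow₀ d.one_le
  have hu2 : ‖u S₀‖ ^ 2 ≤ (L : ℝ) ^ 2 * ‖u S₀‖ ^ 2 := le_mul_of_one_le_left (sq_nonneg _) hL2
  have hv2 : ‖v S₀‖ ^ 2 ≤ ‖v S₀‖ ^ 2 / ρ S₀ :=
    le_div_self (sq_nonneg _) hρ₀ (d.weight_le S₀)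
  have hb : ‖u S₀‖ ^ 2 ≤ G := by linarith [sq_nonneg ‖v S₀‖]
  have hvG : ‖v S₀‖ ^ 2 ≤ G := by linarith [sq_nonneg ‖u S₀‖]
  have hb' : ‖deriv u S₀‖ ^ 2 ≤ (2 + 2 * m ^ 2) * G := by
    rw [← hvu]
    exact norm_sub_mul_sq_le hω0 hωm hvG hb
  have hG0 : 0 ≤ G := (sq_nonneg _).trans hb
  have hI := d.lintegral_Iic_le hωm hw hw0 hw1 hW hen
  simp only [hvu] at hI
  have hO := lintegral_Ioi_energy_le hu.continuous (hu.iterate_deriv' 1 1).continuous hωm hρ₀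
    (ρ := ρ) (fun s hs => by
      rw [hρdef]
      simp only
      rw [div_le_div_iff₀ (hpos _) (hpos _)]
      nlinarith [hmono S₀ s hs.le]) hw2 hX hY
  refine setLIntegral_const_mul_add_le hI hO (by positivity) (by positivity) hz.le
    (ENNReal.ofReal_toReal htop) ?_
  exact combine_constants hκ₀ (by positivity) hm d.one_le hN0 hW0 hρ₀ hKq hE0 hE1 hω1 hyb hG hb hb'

theorem horizon_radii {M E rm rp κ : ℝ} (hM : 0 < M) (hE : |E| < M)
    (hrm : rm = M - Real.sqrt (M ^ 2 - E ^ 2)) (hrp : rp = M + Real.sqrt (M ^ 2 - E ^ 2))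
    (hκ : κ = (M * rp - E ^ 2) / rp ^ 3) :
    0 ≤ rm ∧ rm < rp ∧ rm + rp = 2 * M ∧ rm * rp = E ^ 2 ∧ E ^ 2 ≤ M * rp ∧ 0 < κ := by
  have hsq : E ^ 2 < M ^ 2 := sq_lt_sq' (by linarith [neg_abs_le E]) ((le_abs_self E).trans_lt hE)
  have hx0 : 0 < Real.sqrt (M ^ 2 - E ^ 2) := Real.sqrt_pos.mpr (by linarith)
  have hx2 : Real.sqrt (M ^ 2 - E ^ 2) ^ 2 = M ^ 2 - E ^ 2 := Real.sq_sqrt (by linarith)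
  have hxM : Real.sqrt (M ^ 2 - E ^ 2) ≤ M := by
    rw [Real.sqrt_le_left hM.le]
    linarith [sq_nonneg E]
  have hrp0 : 0 < rp := by linarith
  have hMrp : 0 < M * rp - E ^ 2 := by
    rw [hrp]
    nlinarith [mul_pos hM hx0]
  refine ⟨by linarith, by linarith, by linarith, ?_, by linarith, ?_⟩
  · rw [hrm, hrp]
    linear_combination -hx2
  · rw [hκ]
    positivity

theorem abs_Vpot_le {M m E rp ω K : ℝ} {r : ℝ → ℝ} {L : ℕ} (hrp : 0 < rp) (hr1 : ∀ s, rp < r s)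
    (hL : 1 ≤ L) (hK : 0 ≤ K) (hω : ω ^ 2 ≤ m ^ 2)
    (hQ : ∀ s, |W0 M m E r L s + m ^ 2| ≤ K * (L : ℝ) ^ 2 * ((r s - rp) / r s)) (s : ℝ) :
    |Vpot M m E r ω L s| ≤ (K + m ^ 2) * (L : ℝ) ^ 2 := by
  have h1 : (r s - rp) / r s ≤ 1 := by
    rw [div_le_one (hrp.trans (hr1 s))]
    linarith
  have h2 : K * (L : ℝ) ^ 2 * ((r s - rp) / r s) ≤ K * (L : ℝ) ^ 2 :=
    mul_le_of_le_one_right (by positivity) h1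
  have h3 := abs_le.mp ((hQ s).trans h2)
  have h4 : m ^ 2 ≤ m ^ 2 * (L : ℝ) ^ 2 :=
    le_mul_of_one_le_right (sq_nonneg _) (one_le_pow₀ (by exact_mod_cast hL))
  rw [Vpot_eq, abs_le]
  constructor <;> nlinarith [sq_nonneg ω, h3.1, h3.2]

theorem mul_inv_sq_le {C m L : ℝ} (hm : 0 < m) (hL : 1 ≤ L) (h : 4 * C / (3 * m ^ 2) ≤ L) :
    C * (L ^ 2)⁻¹ ≤ 3 * m ^ 2 / 4 := by
  rw [div_le_iff₀ (by positivity)] at h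
  rw [← div_eq_mul_inv, div_le_iff₀ (by positivity)]
  nlinarith [mul_le_mul_of_nonneg_left (show L ≤ L ^ 2 by nlinarith)
    (show 0 ≤ 3 * m ^ 2 / 4 by positivity)]

theorem one_le_one_add_max_rpow (δ s : ℝ) : 1 ≤ 1 + (max 0 (-s)) ^ (1 + δ) :=
  le_add_of_nonneg_right (Real.rpow_nonneg (le_max_left _ _) _)

theorem continuous_inv_one_add_max_rpow {δ : ℝ} (hδ : 0 < δ) :
    Continuous fun s : ℝ => (1 + (max 0 (-s)) ^ (1 + δ))⁻¹ :=
  Continuous.inv₀ (continuous_const.add ((continuous_const.max continuous_neg).rpow_const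
    fun _ => Or.inr (by linarith))) fun s =>
      (zero_lt_one.trans_le (one_le_one_add_max_rpow δ s)).ne'

theorem inv_one_add_max_rpow_of_nonneg {δ s : ℝ} (hδ : 0 < δ) (hs : 0 ≤ s) :
    (1 + (max 0 (-s)) ^ (1 + δ))⁻¹ = 1 := by
  rw [max_eq_left (by linarith), Real.zero_rpow (by linarith), add_zero, inv_one]

/-- Estimate close to a critical frequency: with EE the distance of m^2 - w^2 to the
nonpositive Dirichlet spectrum, assumed positive but at most exp(-(1/2) LL log LL),
a compactly supported source yields a bound with constant C EE^(-2) exp(D L). -/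
theorem statement12
    (M m E : ℝ) (hM : 0 < M) (hm : 0 < m) (hE : |E| < M)
    (rm rp κ : ℝ)
    (hrm : rm = M - Real.sqrt (M ^ 2 - E ^ 2))
    (hrp : rp = M + Real.sqrt (M ^ 2 - E ^ 2))
    (hκ : κ = (M * rp - E ^ 2) / rp ^ 3)
    (rofs : ℝ → ℝ)
    (hr1 : ∀ s : ℝ, rp < rofs s)
    (hr2 : ∀ s : ℝ, rofs s + (2 * κ)⁻¹ * Real.log ((rofs s - rm) * (rofs s - rp)) = s) :
    ∀ p : ℕ, 2 ≤ p → ∀ C₁ : ℝ, 0 < C₁ →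
    ∃ Sstar : ℝ, 0 < Sstar ∧ ∀ S₀ : ℝ, Sstar ≤ S₀ →
    ∀ δ : ℝ, δ ∈ Set.Ioo (0 : ℝ) 1 →
    ∃ C D : ℝ, 0 < C ∧ 0 < D ∧ ∃ L₀ : ℕ, ∀ L : ℕ, L₀ ≤ L →
    ∀ ω : ℝ, 0 < ω → ω < m →
      ((L : ℝ) ^ p)⁻¹ ≤ m ^ 2 - ω ^ 2 → m ^ 2 - ω ^ 2 ≤ C₁ * ((L : ℝ) ^ 2)⁻¹ →
    ∀ EE : ℝ,
      EE = sInf {x : ℝ | ∃ lam : ℝ, lam ≤ 0 ∧ IsDirichletEV M m E rofs L S₀ lam ∧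
        x = |m ^ 2 - ω ^ 2 + lam|} →
      0 < EE →
      EE ≤ Real.exp (-(1 / 2) * Real.sqrt ((L : ℝ) * ((L : ℝ) + 1)) *
        Real.log (Real.sqrt ((L : ℝ) * ((L : ℝ) + 1)))) →
    ∀ H u : ℝ → ℂ, Continuous H → ContDiff ℝ 2 u →
    (∀ s : ℝ, deriv (deriv u) s - (Vpot M m E rofs ω L s : ℂ) * u s = H s) →
    WeaklyOutgoing ω u →
    (∀ s : ℝ, S₀ < s → H s = 0) →
    (∫⁻ s : ℝ,
        ENNReal.ofReal (rofs s / (rofs s - rp) * ‖deriv u s + Complex.I * (ω : ℂ) * u s‖ ^ 2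
          + (1 + (max 0 (-s)) ^ (1 + δ))⁻¹ * (‖deriv u s‖ ^ 2 + ‖u s‖ ^ 2)))
      ≤ ENNReal.ofReal (C * EE⁻¹ ^ 2 * Real.exp (D * (L : ℝ))) *
        ∫⁻ s in Set.Iic S₀, ENNReal.ofReal (rofs s / (rofs s - rp) * ‖H s‖ ^ 2) := by
  intro p hp C₁ hC₁
  refine ⟨1, one_pos, fun S₀ hS₀ δ hδ => ?_⟩
  obtain ⟨hrm0, hlt, hsum, hprod, hMrp, hκ0⟩ := horizon_radii hM hE hrm hrp hκ
  clear hrm hrp hκ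
  have hrp0 : 0 < rp := hrm0.trans_lt hlt
  have hr := continuous_radius hlt hκ0 hr1 hr2
  obtain ⟨κ₀, hκ₀, ρ', hρ', hρ⟩ := exists_hasDerivAt_ratio hrm0 hlt hκ0 hr1 hr2 S₀
  obtain ⟨W, hW0, hW⟩ := exists_weight_bound hδ.1 (zero_le_one.trans hS₀)
  obtain ⟨K, hKdef⟩ : ∃ K, K = m ^ 2 + 2 / rp ^ 2 + 2 * M / rp ^ 3 := ⟨_, rfl⟩
  have hK : 0 < K := by rw [hKdef]; positivity
  have hρ₀ : 0 < (rofs S₀ - rp) / rofs S₀ :=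
    div_pos (sub_pos.mpr (hr1 S₀)) (hrp0.trans (hr1 S₀))
  refine ⟨16 * ((K + m ^ 2) + 7) ^ 2 * (8 / κ₀ + 8 / (κ₀ * m ^ 2)) *
      ((6 / κ₀ + (1 + 2 * m ^ 2) * W) +
        ((2 / ((rofs S₀ - rp) / rofs S₀) + 1) * (3 + 2 * m ^ 2 + (K + m ^ 2)) +
        (2 * m ^ 2 / ((rofs S₀ - rp) / rofs S₀) + 1))), 2 * (2 * (K + 1) / κ₀) + 8,
    by positivity, by positivity, max (max 1 (2 * p)) ⌈4 * C₁ / (3 * m ^ 2)⌉₊,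
    fun L hL ω hω0 hωm hω1 hω2 EE hEE hE0 hE1 H u hH hu heq hout hH0 => ?_⟩
  have hL1 : 1 ≤ L := (le_max_left _ _).trans ((le_max_left _ _).trans hL)
  have hLp : 2 * p ≤ L := (le_max_right _ _).trans ((le_max_left _ _).trans hL)
  have hLC : 4 * C₁ / (3 * m ^ 2) ≤ L := Nat.ceil_le.mp ((le_max_right _ _).trans hL)
  have hL1' : (1 : ℝ) ≤ L := by exact_mod_cast hL1
  have hEp : EE ≤ ((L : ℝ) ^ p)⁻¹ := hE1.trans (exp_neg_mul_log_le hL1 hLp)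
  have hω3 := mul_inv_sq_le hm hL1' hLC
  have hωsq : ω ^ 2 ≤ m ^ 2 := pow_le_pow_left₀ hω0.le hωm.le 2
  have hQ : ∀ s, |W0 M m E rofs L s + m ^ 2| ≤
      K * (L : ℝ) ^ 2 * ((rofs s - rp) / rofs s) := fun s => by
    rw [hKdef]
    exact abs_W0_add_le hM hrm0 hlt hsum hprod hMrp hr1 hL1 s
  exact energy_estimate (w := fun s => (1 + (max 0 (-s)) ^ (1 + δ))⁻¹) hrp0 hr hr1
    (fun s t h => radius_le_radius hlt hκ0 hr1 hr2 h) (tendsto_radius_atTop hlt hκ0 hr1 hr2)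
    hm hL1 hκ₀ hK.le hρ' hρ hQ (by positivity) (abs_Vpot_le hrp0 hr1 hL1 hK.le hωsq hQ)
    (continuous_inv_one_add_max_rpow hδ.1)
    (fun s => inv_nonneg.mpr (zero_le_one.trans (one_le_one_add_max_rpow δ s)))
    (fun s => inv_le_one_of_one_le₀ (one_le_one_add_max_rpow δ s))
    (fun s hs => inv_one_add_max_rpow_of_nonneg hδ.1 (by linarith)) hW0 hW hω0 (by linarith) hEE
    hE0 (hEp.trans (inv_le_one_of_one_le₀ (one_le_pow₀ hL1'))) (hEp.trans hω1) hH hu heq hout hH0
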